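/- arXiv:0807.4761 — 10 statements merged into one kernel-verified Lean document; each statement's English description precedes it below -/
import Mathlib

section
/- Let μ be a faithful Borel probability measure on [0,1]. Then for every natural number k ≥ 1 and every ε > 0 there exist a natural number m and continuous functions f₀, f₁, …, f_{k−1} : [0,1]^m → [0,1] such that f_i · f_j = 0 whenever i ≠ j, σ_m(f_j) = f_{j+1} for j = 0, 1, …, k−2, and ∫_{[0,1]^m} (1 − Σ_{j=0}^{k−1} f_j) dμ_m < ε. -/
open MeasureTheory

/-- The points whose first visit to `E` under the iterates of `T` happens at a time congruent to
`k - 1` modulo `k`. -/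
def towerBase {X : Type*} (T : X → X) (E : Set X) (k : ℕ) : Set X :=
  {x | ∃ n, n % k = k - 1 ∧ T^[n] x ∈ E ∧ ∀ i < n, T^[i] x ∉ E}

lemma measurableSet_towerBase {X : Type*} [MeasurableSpace X] {T : X → X} (hT : Measurable T)
    {E : Set X} (hE : MeasurableSet E) (k : ℕ) : MeasurableSet (towerBase T E k) := by
  have h : towerBase T E k =
      ⋃ n ∈ {n : ℕ | n % k = k - 1}, (T^[n] ⁻¹' E ∩ ⋂ i ∈ Set.Iio n, (T^[i] ⁻¹' E)ᶜ) := by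
    ext x
    simp [towerBase, and_left_comm]
  rw [h]
  refine MeasurableSet.biUnion (Set.to_countable _) fun n _ => ?_
  refine (hT.iterate n hE).inter ?_
  exact MeasurableSet.biInter (Set.to_countable _) fun i _ => (hT.iterate i hE).compl

lemma iterate_notMem_towerBase {X : Type*} {T : X → X} {E : Set X} {k l : ℕ} (hl : 1 ≤ l)
    (hlk : l < k) {x : X} (hx : x ∈ towerBase T E k) : T^[l] x ∉ towerBase T E k := by
  rintro ⟨n', hn', hE', hmin'⟩
  obtain ⟨n, hn, hE, hmin⟩ := hx
  have hln : l ≤ n := by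
    have := Nat.mod_le n k
    omega
  obtain ⟨d, rfl⟩ := Nat.exists_eq_add_of_le' hln
  rw [Function.iterate_add_apply] at hE
  rw [← Function.iterate_add_apply] at hE'
  have hd : n' = d := by
    rcases lt_trichotomy n' d with h | h | h
    · exact absurd hE' (hmin _ (by omega))
    · exact h
    · exact absurd hE (hmin' _ h)
  subst hd
  have h : (n' + l) % k = (n' + 0) % k := by rw [hn, add_zero, hn']
  have h2 : l ≡ 0 [MOD k] := Nat.ModEq.add_left_cancel' n' h
  have h3 : l % k = 0 := by simpa [Nat.ModEq] using h2
  rw [Nat.mod_eq_of_lt hlk] at h3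
  omega

lemma exists_iterate_mem_towerBase {X : Type*} {S T : X → X} (hTS : Function.LeftInverse T S)
    {E : Set X} {k : ℕ} (hk : 1 ≤ k) {x : X} (hx : ∃ n, T^[n] x ∈ E)
    (hS : ∀ j < k, S^[j] x ∉ E) : ∃ j < k, S^[j] x ∈ towerBase T E k := by
  classical
  have hmod : Nat.find hx % k < k := Nat.mod_lt _ hk
  refine ⟨k - 1 - Nat.find hx % k, by omega, Nat.find hx + (k - 1 - Nat.find hx % k), ?_, ?_, ?_⟩
  · generalize Nat.find hx = n at *
    have hn : n + (k - 1 - n % k) = k * (n / k) + (k - 1) := by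
      have := Nat.div_add_mod n k
      omega
    rw [hn, Nat.mul_add_mod, Nat.mod_eq_of_lt (by omega)]
  · rw [Function.iterate_add_apply, hTS.iterate]
    exact Nat.find_spec hx
  · intro i hi
    generalize hj : k - 1 - Nat.find hx % k = j at *
    rcases le_total j i with h | h
    · obtain ⟨d, rfl⟩ := Nat.exists_eq_add_of_le' h
      rw [Function.iterate_add_apply, hTS.iterate]
      exact Nat.find_min hx (by omega)
    · obtain ⟨d, rfl⟩ := Nat.exists_eq_add_of_le h
      rw [Function.iterate_add_apply, hTS.iterate]
      exact hS d (by omega)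

lemma exists_continuous_mul_iterate_eq_zero {X : Type*} [TopologicalSpace X] [NormalSpace X]
    {S T : X → X} (hS : Continuous S) (hT : Continuous T) (hTS : Function.LeftInverse T S)
    (hST : Function.LeftInverse S T) {K : Set X} (hK : IsClosed K) {k : ℕ}
    (hdisj : ∀ l, 1 ≤ l → l < k → ∀ x ∈ K, S^[l] x ∉ K) :
    ∃ f : C(X, ℝ), (∀ x, f x ∈ Set.Icc (0 : ℝ) 1) ∧ (∀ x ∈ K, f x = 1) ∧
      ∀ l, 1 ≤ l → l < k → ∀ x, f x * f (S^[l] x) = 0 := by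
  obtain ⟨h, h0, h1, h01⟩ := exists_continuous_zero_one_of_isClosed
    (s := ⋃ l ∈ Finset.Ico 1 k, (S^[l] ⁻¹' K ∪ T^[l] ⁻¹' K)) (t := K)
    (isClosed_biUnion_finset fun l _ =>
      (hK.preimage (hS.iterate l)).union (hK.preimage (hT.iterate l))) hK (by
      rw [Set.disjoint_right]
      intro x hx hx'
      simp only [Set.mem_iUnion, Finset.mem_Ico] at hx'
      obtain ⟨l, ⟨hl, hlk⟩, hS' | hT'⟩ := hx'
      · exact hdisj l hl hlk x hx hS'
      · refine hdisj l hl hlk _ hT' ?_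
        rwa [hST.iterate l x])
  have hnn : ∀ x, 0 ≤ h x := fun x => (h01 x).1
  let F : X → ℝ := fun x => max 0 (h x - ∑ l ∈ Finset.Ico 1 k, (h (S^[l] x) + h (T^[l] x)))
  have hF : Continuous F := by
    refine continuous_const.max (h.continuous.sub (continuous_finsetSum _ fun l _ => ?_))
    exact (h.continuous.comp (hS.iterate l)).add (h.continuous.comp (hT.iterate l))
  have hsum : ∀ x, 0 ≤ ∑ l ∈ Finset.Ico 1 k, (h (S^[l] x) + h (T^[l] x)) := fun x =>
    Finset.sum_nonneg fun l _ => add_nonneg (hnn _) (hnn _)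
  have hle : ∀ x l, 1 ≤ l → l < k → h (S^[l] x) + h (T^[l] x) ≤
      ∑ l ∈ Finset.Ico 1 k, (h (S^[l] x) + h (T^[l] x)) := fun x l hl hlk =>
    Finset.single_le_sum (f := fun l => h (S^[l] x) + h (T^[l] x))
      (fun l _ => add_nonneg (hnn _) (hnn _)) (Finset.mem_Ico.2 ⟨hl, hlk⟩)
  refine ⟨⟨F, hF⟩, fun x => ⟨le_max_left _ _, max_le zero_le_one ?_⟩, fun x hx => ?_,
    fun l hl hlk x => ?_⟩
  · linarith [hsum x, (h01 x).2]
  · have hz : ∑ l ∈ Finset.Ico 1 k, (h (S^[l] x) + h (T^[l] x)) = 0 := by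
      refine Finset.sum_eq_zero fun l hl => ?_
      rw [h0 (x := S^[l] x), h0 (x := T^[l] x)]
      · simp
      · refine Set.mem_biUnion hl (Or.inl ?_)
        simpa [hST.iterate l x] using hx
      · refine Set.mem_biUnion hl (Or.inr ?_)
        simpa [hTS.iterate l x] using hx
    simp [F, hz, h1 hx]
  · change F x * F (S^[l] x) = 0
    have e1 := hle x l hl hlk
    have e2 := hle (S^[l] x) l hl hlk
    rw [hTS.iterate l x] at e2
    rcases le_total (h x) (h (S^[l] x)) with hx | hx
    · have : F x = 0 := max_eq_left (by linarith [hnn (T^[l] x)])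
      simp [this]
    · have : F (S^[l] x) = 0 := max_eq_left (by linarith [hnn (S^[l] (S^[l] x))])
      simp [this]

/-- A Rokhlin tower of continuous functions. -/
lemma exists_continuous_rokhlin_tower {X : Type*} [TopologicalSpace X] [CompactSpace X]
    [TopologicalSpace.PseudoMetrizableSpace X] [MeasurableSpace X] [BorelSpace X]
    {P : Measure X} [IsProbabilityMeasure P] {S T : X → X} (hS : Continuous S)
    (hT : Continuous T) (hTS : Function.LeftInverse T S) (hST : Function.LeftInverse S T)
    (hP : MeasurePreserving S P P) {E : Set X} (hE : MeasurableSet E) {k : ℕ} (hk : 1 ≤ k)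
    {δ : ℝ} (hδ : 0 < δ) :
    ∃ f : C(X, ℝ), (∀ x, f x ∈ Set.Icc (0 : ℝ) 1) ∧
      (∀ l, 1 ≤ l → l < k → ∀ x, f x * f (S^[l] x) = 0) ∧
      ∫ x, (1 - ∑ j : Fin k, f (S^[j] x)) ∂P ≤
        P.real {x | ∀ n, T^[n] x ∉ E} + k * P.real E + k * δ := by
  have hFm : MeasurableSet (towerBase T E k) := measurableSet_towerBase hT.measurable hE k
  obtain ⟨K, hKF, hK, hKδ⟩ := hFm.exists_isClosed_sdiff_lt (μ := P) (measure_ne_top _ _)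
    (ENNReal.ofReal_pos.2 hδ).ne'
  obtain ⟨f, hf01, hf1, hf⟩ := exists_continuous_mul_iterate_eq_zero hS hT hTS hST hK (k := k)
    (fun l hl hlk x hx hx' => iterate_notMem_towerBase hl hlk (hKF hx')
      ((hTS.iterate l x).symm ▸ hKF hx))
  refine ⟨f, hf01, hf, ?_⟩
  set C : Set X := (⋃ j ∈ Finset.range k, S^[j] ⁻¹' K)ᶜ with hC
  have hCm : MeasurableSet C := (Finset.measurableSet_biUnion _ fun j _ =>
    (hK.preimage (hS.iterate j)).measurableSet).compl
  have hreal : ∀ (A : Set X), MeasurableSet A → ∀ j, P.real (S^[j] ⁻¹' A) = P.real A :=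
    fun A hA j => (hP.iterate j).measureReal_preimage hA.nullMeasurableSet
  have hcover : C ⊆ {x | ∀ n, T^[n] x ∉ E} ∪ (⋃ j ∈ Finset.range k, S^[j] ⁻¹' E) ∪
      ⋃ j ∈ Finset.range k, S^[j] ⁻¹' (towerBase T E k \ K) := by
    intro x hx
    by_contra hcon
    simp only [hC, Set.mem_union, Set.mem_ofPred_eq, Set.mem_iUnion, Finset.mem_range,
      Set.mem_preimage, Set.mem_sdiff, Set.mem_compl_iff] at hx hcon
    push Not at hx hcon
    obtain ⟨⟨h1, h2⟩, h3⟩ := hcon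
    obtain ⟨j, hj, hjm⟩ := exists_iterate_mem_towerBase hTS hk h1 h2
    exact hx j hj (h3 j hj hjm)
  have hPC : P.real C ≤ P.real {x | ∀ n, T^[n] x ∉ E} + k * P.real E + k * δ := by
    have hsum : ∀ A : Set X, MeasurableSet A →
        P.real (⋃ j ∈ Finset.range k, S^[j] ⁻¹' A) ≤ k * P.real A := fun A hA => by
      refine (measureReal_biUnion_finset_le _ _).trans_eq ?_
      simp [hreal A hA]
    have hKδ' : P.real (towerBase T E k \ K) ≤ δ :=
      ENNReal.toReal_le_of_le_ofReal hδ.le hKδ.le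
    have hkδ : (k : ℝ) * P.real (towerBase T E k \ K) ≤ k * δ := by gcongr
    refine (measureReal_mono hcover).trans ((measureReal_union_le _ _).trans ?_)
    exact add_le_add ((measureReal_union_le _ _).trans (add_le_add le_rfl (hsum E hE)))
      ((hsum _ (hFm.diff hK.measurableSet)).trans hkδ)
  refine le_trans ?_ hPC
  rw [← integral_indicator_one hCm]
  refine integral_mono ?_ ((integrable_const (1 : ℝ)).indicator hCm) fun x => ?_
  · have hcont : Continuous fun x => 1 - ∑ j : Fin k, f (S^[j] x) :=
      continuous_const.sub (continuous_finsetSum _ fun j _ => f.continuous.comp (hS.iterate j))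
    exact hcont.integrable_of_hasCompactSupport (HasCompactSupport.of_compactSpace _)
  · have hnn : ∀ j ∈ (Finset.univ : Finset (Fin k)), 0 ≤ f (S^[j] x) := fun j _ => (hf01 _).1
    by_cases hx : x ∈ C
    · simp only [Set.indicator_of_mem hx, Pi.one_apply]
      linarith [Finset.sum_nonneg hnn]
    · rw [Set.indicator_of_notMem hx]
      simp only [hC, Set.mem_compl_iff, not_not, Set.mem_iUnion, Finset.mem_range] at hx
      obtain ⟨j, hj, hjx⟩ := hx
      have := Finset.single_le_sum hnn (Finset.mem_univ ⟨j, hj⟩)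
      rw [hf1 _ hjx] at this
      linarith

lemma exists_measureReal_pos_lt_of_faithful (μ : Measure (Set.Icc (0:ℝ) 1))
    [IsProbabilityMeasure μ]
    (hfaith : ∀ f : C(Set.Icc (0:ℝ) 1, ℝ), (∀ x, 0 ≤ f x) → ∫ x, f x ∂μ = 0 → f = 0)
    {δ : ℝ} (hδ : 0 < δ) :
    ∃ A : Set (Set.Icc (0:ℝ) 1), MeasurableSet A ∧ 0 < μ.real A ∧ μ.real A < δ := by
  let A : ℕ → Set (Set.Icc (0:ℝ) 1) := fun n => {x | 0 < (x : ℝ) ∧ (x : ℝ) < 1 / ((n : ℝ) + 1)}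
  have hAm : ∀ n, MeasurableSet (A n) := fun n =>
    (measurableSet_lt measurable_const measurable_subtype_coe).inter
      (measurableSet_lt measurable_subtype_coe measurable_const)
  have hanti : Antitone A := fun m n hmn x hx =>
    ⟨hx.1, hx.2.trans_le (one_div_le_one_div_of_le (by positivity) (by gcongr))⟩
  have hempty : ⋂ n, A n = ∅ := by
    refine Set.eq_empty_of_forall_notMem fun x hx => ?_
    rw [Set.mem_iInter] at hx
    obtain ⟨n, hn⟩ := exists_nat_one_div_lt (hx 0).1
    exact lt_asymm hn (hx n).2
  have hlim := tendsto_measure_iInter_atTop (μ := μ) (fun n => (hAm n).nullMeasurableSet) hanti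
    ⟨0, measure_ne_top _ _⟩
  rw [hempty, measure_empty] at hlim
  obtain ⟨n, hn⟩ := (hlim.eventually_lt_const (ENNReal.ofReal_pos.2 hδ)).exists
  refine ⟨A n, hAm n, ?_, ENNReal.toReal_lt_of_lt_ofReal hn⟩
  refine lt_of_le_of_ne measureReal_nonneg fun h0 => ?_
  set c : ℝ := 1 / ((n : ℝ) + 1) with hc
  have hc0 : 0 < c := by positivity
  have hc1 : c ≤ 1 := by
    rw [hc, div_le_one (by positivity)]
    linarith [n.cast_nonneg (α := ℝ)]
  let f : C(Set.Icc (0:ℝ) 1, ℝ) := ⟨fun x => max 0 ((x : ℝ) * (c - x)), by fun_prop⟩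
  have hf : f = 0 := by
    refine hfaith f (fun x => le_max_left _ _) (integral_eq_zero_of_ae ?_)
    have hnull : μ (A n) = 0 := (measureReal_eq_zero_iff).1 h0.symm
    filter_upwards [measure_eq_zero_iff_ae_notMem.1 hnull] with x hx
    refine max_eq_left ?_
    by_contra! hpos
    have hx0 : (0 : ℝ) < x := lt_of_le_of_ne x.2.1 (left_ne_zero_of_mul hpos.ne').symm
    exact hx ⟨hx0, sub_pos.1 ((mul_pos_iff_of_pos_left hx0).1 hpos)⟩
  have hval := DFunLike.congr_fun hf ⟨c / 2, by positivity, by linarith⟩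
  have hval' : max 0 (c / 2 * (c - c / 2)) = 0 := hval
  have : 0 < c / 2 * (c - c / 2) := mul_pos (by linarith) (by linarith)
  exact absurd (max_eq_left_iff.1 hval') (not_le.2 this)

lemma comp_finRotate_iterate_apply_zero {α : Type*} {M : ℕ} (t : Fin (M + 1) → α)
    (i : Fin (M + 1)) : (fun s : Fin (M + 1) → α => fun j => s (finRotate _ j))^[i] t 0 = t i := by
  have h : ∀ (n : ℕ) (t : Fin (M + 1) → α) (j : Fin (M + 1)),
      (fun s : Fin (M + 1) → α => fun j => s (finRotate _ j))^[n] t j =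
        t (j + Fin.ofNat (M + 1) n) := by
    intro n
    induction n with
    | zero => intro t j; simp
    | succ n ih =>
      intro t j
      rw [Function.iterate_succ_apply, ih, finRotate_apply, add_assoc]
      congr 2
      ext
      simp [Fin.val_add]
  rw [h]
  simp


open MeasureTheory

/-- Let `μ` be a faithful Borel probability measure on `[0,1]`. Then for every
`k ≥ 1` and `ε > 0` there exist `m ∈ ℕ` and continuous functions
`f₀, …, f_{k-1} : [0,1]^m → [0,1]` which are pairwise orthogonal, are cyclically shifted into
each other (`σ_m (f j) = f (j+1)` for `j = 0, …, k-2`, where `σ_m` is the cyclic coordinate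
shift `(σ_m f)(t) = f(s)` with `s_i = t_{i-1}`, i.e. `s = t ∘ (finRotate m).symm`), and satisfy
`∫ (1 - ∑ j, f j) dμ_m < ε`. -/
theorem stmt0 (μ : Measure (Set.Icc (0:ℝ) 1)) [IsProbabilityMeasure μ]
    (hfaith : ∀ f : C(Set.Icc (0:ℝ) 1, ℝ), (∀ x, 0 ≤ f x) → ∫ x, f x ∂μ = 0 → f = 0)
    (k : ℕ) (hk : 1 ≤ k) (ε : ℝ) (hε : 0 < ε) :
    ∃ (m : ℕ) (f : Fin k → C((Fin m → Set.Icc (0:ℝ) 1), ℝ)),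
      (∀ j t, f j t ∈ Set.Icc (0:ℝ) 1) ∧
      (∀ i j, i ≠ j → ∀ t, f i t * f j t = 0) ∧
      (∀ (j : ℕ) (h : j + 1 < k), ∀ t,
        f ⟨j + 1, h⟩ t = f ⟨j, Nat.lt_of_succ_lt h⟩ (fun i => t ((finRotate m).symm i))) ∧
      ∫ t, (1 - ∑ j, f j t) ∂(Measure.pi fun _ : Fin m => μ) < ε := by
  have hk0 : (0 : ℝ) < k := by exact_mod_cast hk
  obtain ⟨A, hA, hA0, hAδ⟩ := exists_measureReal_pos_lt_of_faithful μ hfaith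
    (δ := ε / (4 * k)) (by positivity)
  have hAc : μ.real Aᶜ < 1 := by
    rw [probReal_compl_eq_one_sub hA]
    linarith
  obtain ⟨M, hM⟩ := exists_pow_lt_of_lt_one (show (0 : ℝ) < ε / 4 by positivity) hAc
  set T : (Fin (M + 1) → Set.Icc (0:ℝ) 1) → (Fin (M + 1) → Set.Icc (0:ℝ) 1) :=
    fun t i => t (finRotate _ i)
  set S : (Fin (M + 1) → Set.Icc (0:ℝ) 1) → (Fin (M + 1) → Set.Icc (0:ℝ) 1) :=
    fun t i => t ((finRotate _).symm i)
  have hP : MeasurePreserving S (Measure.pi fun _ => μ) (Measure.pi fun _ => μ) := by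
    convert measurePreserving_piCongrLeft (fun _ => μ) (finRotate (M + 1)) using 1
    funext t i
    obtain ⟨i, rfl⟩ := (finRotate (M + 1)).surjective i
    rw [MeasurableEquiv.coe_piCongrLeft, Equiv.piCongrLeft_apply_apply]
    simp [S]
  have hE : MeasurableSet ((fun t : Fin (M + 1) → Set.Icc (0:ℝ) 1 => t 0) ⁻¹' A) :=
    measurable_pi_apply 0 hA
  obtain ⟨f, hf01, hf, hint⟩ := exists_continuous_rokhlin_tower (S := S) (T := T)
    (by fun_prop) (by fun_prop) (fun t => by simp [S, T]) (fun t => by simp [S, T]) hP hE hk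
    (δ := ε / (4 * k)) (by positivity)
  have hS : Continuous S := by fun_prop
  have hmul : ∀ i j : Fin k, i < j → ∀ t, f (S^[i] t) * f (S^[j] t) = 0 := fun i j hij t => by
    have hji : (j : ℕ) = (j - i : ℕ) + i := by omega
    rw [hji, Function.iterate_add_apply]
    exact hf _ (by omega) (by omega) _
  refine ⟨M + 1, fun j => f.comp ⟨S^[j], hS.iterate j⟩, fun j t => hf01 _, fun i j hij t => ?_,
    fun j h t => ?_, hint.trans_lt ?_⟩
  · rcases lt_or_gt_of_ne hij with h | h
    · exact hmul i j h t
    · exact (mul_comm _ _).trans (hmul j i h t)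
  · exact congrArg f (Function.iterate_succ_apply S j t)
  · have hEA : (Measure.pi fun _ : Fin (M + 1) => μ).real
        ((fun t : Fin (M + 1) → Set.Icc (0:ℝ) 1 => t 0) ⁻¹' A) = μ.real A :=
      (measurePreserving_eval (fun _ : Fin (M + 1) => μ) 0).measureReal_preimage
        hA.nullMeasurableSet
    have hZ : (Measure.pi fun _ : Fin (M + 1) => μ).real
        {t | ∀ n, T^[n] t ∉ (fun t : Fin (M + 1) → Set.Icc (0:ℝ) 1 => t 0) ⁻¹' A} ≤
        μ.real Aᶜ ^ (M + 1) := by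
      refine (measureReal_mono (s₂ := Set.univ.pi fun _ => Aᶜ) ?_).trans_eq ?_
      · intro t ht i _
        have := ht i
        rwa [Set.mem_preimage, comp_finRotate_iterate_apply_zero] at this
      · simp [measureReal_def, Measure.pi_pi]
    have hZ' : μ.real Aᶜ ^ (M + 1) ≤ μ.real Aᶜ ^ M :=
      pow_le_pow_of_le_one measureReal_nonneg hAc.le (Nat.le_succ M)
    have hkk : (k : ℝ) * (ε / (4 * k)) = ε / 4 := by field_simp
    have hkA : (k : ℝ) * μ.real A ≤ ε / 4 := by
      rw [← hkk]
      gcongr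
    rw [hEA, hkk]
    linarith
end

section
/- Let A be a unital C*-algebra of real rank zero, and suppose that the order on projections in A is determined by traces, i.e., whenever p, q are projections in A with τ(p) < τ(q) for every tracial state τ on A, there exists w ∈ A with w*·w = p and w·w* ≤ q. If e and f are nonzero projections in A such that 2·τ(e) < τ(f) for every tracial state τ on A, then for every ε > 0 there exists w ∈ A such that w*·w = e, w·w* ≤ f, and ‖w²‖ < ε. -/
open scoped ComplexOrder

/-- A tracial state on a unital C*-algebra: a linear functional `τ` with `τ 1 = 1`,
`τ (a* a) ≥ 0` for all `a`, and `τ (a b) = τ (b a)` for all `a, b`. -/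
def IsTracialState {A : Type*} [CStarAlgebra A] (τ : A →ₗ[ℂ] ℂ) : Prop :=
  τ 1 = 1 ∧ (∀ a : A, 0 ≤ τ (star a * a)) ∧ ∀ a b : A, τ (a * b) = τ (b * a)

/-- A projection in a C*-algebra: a self-adjoint idempotent. -/
def IsProjection {A : Type*} [Mul A] [Star A] (p : A) : Prop :=
  star p = p ∧ p * p = p

section

variable {A : Type*}

theorem IsProjection.isStarProjection [Mul A] [Star A] {p : A} (hp : IsProjection p) :
    IsStarProjection p :=
  ⟨hp.2, hp.1⟩

theorem IsStarProjection.isProjection [Mul A] [Star A] {p : A} (hp : IsStarProjection p) :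
    IsProjection p :=
  ⟨hp.2, hp.1⟩

/-- If the corner `(1 - f) b (1 - f)` of a self-adjoint invertible `b` is invertible, then so is
the Schur complement: it is a corner of a self-adjoint invertible commuting with `f`. -/
theorem exists_schur_complement [Ring A] [StarRing A] {f b c : A} (hf : IsStarProjection f)
    (hb : IsSelfAdjoint b) (hbu : IsUnit b)
    (hc : c * ((1 - f) * b * (1 - f) + f) = 1) (hc' : ((1 - f) * b * (1 - f) + f) * c = 1) :
    ∃ s : A, IsSelfAdjoint s ∧ IsUnit s ∧ Commute s f ∧
      f * s * f = f * b * f - (f * b * (1 - f)) * c * ((1 - f) * b * f) := by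
  obtain ⟨q, hq⟩ : ∃ q, q = 1 - f := ⟨_, rfl⟩
  rw [← hq] at hc hc' ⊢
  have hff : f * f = f := hf.1
  have hqq : q * q = q := by rw [hq]; exact hf.one_sub.1
  have hfq : f * q = 0 := by rw [hq]; exact hf.mul_one_sub_self
  have hqf : q * f = 0 := by rw [hq]; exact hf.one_sub_mul_self
  have hsf : star f = f := hf.2
  have hsq : star q = q := by rw [hq]; exact hf.one_sub.2
  have hsb : star b = b := hb
  have hTq : (q * b * q + f) * q = q * b * q := by
    rw [add_mul, hfq, add_zero, mul_assoc, hqq]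
  have hqT : q * (q * b * q + f) = q * b * q := by
    rw [mul_add, hqf, add_zero, ← mul_assoc, ← mul_assoc, hqq]
  have hcqbq : c * (q * b * q) = q := by rw [← hTq, ← mul_assoc, hc, one_mul]
  have hqbqc : q * b * q * c = q := by rw [← hqT, mul_assoc, hc', mul_one]
  have hcq : c * q = q * c := by
    calc c * q = c * (q * b * q * c) := by rw [hqbqc]
      _ = c * (q * b * q) * c := by simp only [mul_assoc]
      _ = q * c := by rw [hcqbq]
  have hsc : star c = c := by
    have h1 : (q * b * q + f) * star c = 1 := by
      have := congrArg star hc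
      simpa [hsq, hsb, hsf, mul_assoc] using this
    calc star c = c * (q * b * q + f) * star c := by rw [hc, one_mul]
      _ = c := by rw [mul_assoc, h1, mul_one]
  obtain ⟨n, hn⟩ : ∃ n, n = f * b * q * c := ⟨_, rfl⟩
  have hn' : n = f * b * c * q := by
    rw [hn, mul_assoc, ← hcq, ← mul_assoc]
  have hsn : star n = q * (c * b * f) := by
    rw [hn']; simp [hsq, hsb, hsf, hsc, mul_assoc]
  have hfn : f * n = n := by
    rw [hn]; simp only [← mul_assoc, hff]
  have hnf : n * f = 0 := by rw [hn', mul_assoc, hqf, mul_zero]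
  have hnn : n * n = 0 := by
    rw [← hfn, mul_assoc, ← mul_assoc n f n, hnf, zero_mul, mul_zero]
  have hsnq : star n * q = 0 := by
    rw [hsn]; simp only [mul_assoc, hfq, mul_zero]
  have hkey : (f - n) * b * q = 0 := by
    have : n * b * q = f * b * q := by
      calc n * b * q = f * b * (c * (q * b * q)) := by rw [hn']; simp only [mul_assoc]
        _ = f * b * q := by rw [hcqbq]
    rw [sub_mul, sub_mul, this, sub_self]
  have hf1n : f * (1 - n) = f - n := by rw [mul_sub, mul_one, hfn]
  obtain ⟨s, hs⟩ : ∃ s, s = (1 - n) * b * star (1 - n) := ⟨_, rfl⟩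
  have hss : IsSelfAdjoint s := by rw [hs]; exact hb.conjugate (1 - n)
  have hnu : IsUnit (1 - n) :=
    ⟨⟨1 - n, 1 + n, by simp [mul_add, sub_mul, hnn], by simp [mul_sub, add_mul, hnn]⟩, rfl⟩
  have hfs : f * s = (f - n) * b * star (1 - n) := by
    rw [hs, ← mul_assoc, ← mul_assoc, hf1n]
  have hfsq : f * s * q = 0 := by
    rw [hfs, mul_assoc, star_sub, star_one, sub_mul 1, hsnq, one_mul, sub_zero, hkey]
  have hfsf : f * s * f = f * s := by
    have h : f * s * (f + q) = f * s := by rw [hq, add_sub_cancel, mul_one]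
    rwa [mul_add, hfsq, add_zero] at h
  refine ⟨s, hss, ?_, ?_, ?_⟩
  · rw [hs]; exact (hnu.mul hbu).mul hnu.star
  · have h := congrArg star hfsf
    simp only [star_mul, hsf, hss.star_eq] at h
    rw [← mul_assoc, hfsf] at h
    exact h.symm
  · have h0 : (f - n) * b * star n = 0 := by
      rw [hsn, ← mul_assoc, hkey, zero_mul]
    rw [hfs, star_sub, star_one, mul_sub, mul_one, h0, sub_zero, sub_mul, sub_mul, hn']
    rw [sub_right_inj]
    calc f * b * c * q * b * f = f * b * (c * q) * b * f := by simp only [mul_assoc]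
      _ = f * b * (q * q * c) * b * f := by rw [hcq, hqq]
      _ = f * b * (q * (c * q)) * b * f := by rw [hcq, mul_assoc q q c]
      _ = _ := by simp only [mul_assoc]

variable [CStarAlgebra A]

/-- In a C*-algebra of real rank zero the corner `f A f` has real rank zero. -/
theorem exists_isUnit_commute_norm_lt
    (hRR0 : ∀ a : A, IsSelfAdjoint a → ∀ ε > (0:ℝ), ∃ b : A,
      IsSelfAdjoint b ∧ IsUnit b ∧ ‖a - b‖ < ε)
    {f x : A} (hf : IsStarProjection f) (hx : IsSelfAdjoint x) (hfx : f * x * f = x)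
    {κ : ℝ} (hκ : 0 < κ) :
    ∃ s : A, IsSelfAdjoint s ∧ IsUnit s ∧ Commute s f ∧ ‖f * s * f - x‖ ≤ κ := by
  obtain ⟨η, hη0, hη1, hηκ⟩ : ∃ η : ℝ, 0 < η ∧ η ≤ 1 / 2 ∧ 2 * η ≤ κ :=
    ⟨min (1 / 2) (κ / 2), by positivity, min_le_left _ _, by
      have := min_le_right (1 / 2) (κ / 2); linarith⟩
  obtain ⟨q, hq⟩ : ∃ q, q = 1 - f := ⟨_, rfl⟩
  have hff : f * f = f := hf.1
  have hqp : IsStarProjection q := hq ▸ hf.one_sub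
  have hfq : f * q = 0 := by rw [hq]; exact hf.mul_one_sub_self
  have hqf : q * f = 0 := by rw [hq]; exact hf.one_sub_mul_self
  have hxq : x * q = 0 := by rw [← hfx, mul_assoc, hfq, mul_zero]
  have hqx : q * x = 0 := by rw [← hfx, ← mul_assoc, ← mul_assoc, hqf, zero_mul, zero_mul]
  obtain ⟨b, hb, hbu, hab⟩ := hRR0 (x + q) (hx.add hqp.2) η hη0
  obtain ⟨t, ht⟩ : ∃ t, t = b - (x + q) := ⟨_, rfl⟩
  have htn : ‖t‖ ≤ η := by rw [ht, norm_sub_rev]; exact hab.le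
  have hbt : b = x + q + t := by rw [ht]; abel
  have comp : ∀ u v w : A, IsStarProjection u → IsStarProjection w → ‖v‖ ≤ η →
      ‖u * v * w‖ ≤ η := by
    intro u v w hu hw hv
    calc ‖u * v * w‖ ≤ ‖u‖ * ‖v‖ * ‖w‖ := norm_mul₃_le
      _ ≤ 1 * η * 1 := by gcongr <;> first | exact hu.norm_le | exact hw.norm_le
      _ = η := by ring
  have hfbf : f * b * f = x + f * t * f := by
    rw [hbt, mul_add, mul_add, hfq, add_mul, add_zero, hfx]
  have hfbq : f * b * q = f * t * q := by
    rw [hbt, mul_add, mul_add, hfq, add_zero, add_mul, mul_assoc, hxq, mul_zero, zero_add]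
  have hqbf : q * b * f = q * t * f := by
    rw [hbt, mul_add, mul_add, hqx, zero_add, add_mul, hqp.1.eq, hqf, zero_add]
  have hqbq : q * b * q + f = 1 + q * t * q := by
    rw [hbt, mul_add, mul_add, hqx, zero_add, add_mul, hqp.1.eq, hqp.1.eq, hq]; abel
  have hr : ‖q * t * q‖ ≤ η := comp q t q hqp hqp htn
  obtain ⟨c, hc, hc'⟩ : ∃ c : A, c * (q * b * q + f) = 1 ∧ (q * b * q + f) * c = 1 := by
    have hu : IsUnit (1 - -(q * t * q)) :=
      (Units.oneSub (-(q * t * q)) (by rw [norm_neg]; linarith)).isUnit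
    rw [sub_neg_eq_add, ← hqbq] at hu
    obtain ⟨u, hu⟩ := hu
    exact ⟨↑u⁻¹, by rw [← hu, Units.inv_mul], by rw [← hu, Units.mul_inv]⟩
  have hcn : ‖c‖ ≤ 2 := by
    have h1 : c = 1 - c * (q * t * q) := by
      rw [hqbq, mul_add, mul_one] at hc
      exact eq_sub_of_add_eq hc
    have h2 : ‖c‖ ≤ ‖(1 : A)‖ + ‖c‖ * ‖q * t * q‖ := by
      calc ‖c‖ = ‖1 - c * (q * t * q)‖ := by rw [← h1]
        _ ≤ ‖(1 : A)‖ + ‖c * (q * t * q)‖ := norm_sub_le _ _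
        _ ≤ _ := by gcongr; exact norm_mul_le _ _
    have h3 : ‖(1 : A)‖ ≤ 1 := IsStarProjection.norm_le (1 : A) (.one A)
    nlinarith [norm_nonneg c, mul_le_mul_of_nonneg_left (hr.trans hη1) (norm_nonneg c)]
  subst hq
  obtain ⟨s, hs, hsu, hsf, hfsf⟩ := exists_schur_complement hf hb hbu hc hc'
  refine ⟨s, hs, hsu, hsf, ?_⟩
  rw [hfsf, hfbf, hfbq, hqbf, add_sub_assoc, add_sub_cancel_left]
  calc _ ≤ ‖f * t * f‖ + ‖f * t * (1 - f) * c * ((1 - f) * t * f)‖ := norm_sub_le _ _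
    _ ≤ ‖f * t * f‖ + ‖f * t * (1 - f)‖ * ‖c‖ * ‖(1 - f) * t * f‖ := by
      gcongr; exact norm_mul₃_le
    _ ≤ η + η * 2 * η := by
      gcongr
      · exact comp _ _ _ hf hf htn
      · exact comp _ _ _ hf hqp htn
      · exact comp _ _ _ hqp hf htn
    _ ≤ κ := by nlinarith

theorem IsTracialState.re_nonneg {τ : A →ₗ[ℂ] ℂ} (hτ : IsTracialState τ) {p : A}
    (hp : IsStarProjection p) : 0 ≤ (τ p).re := by
  have h := hτ.2.1 p
  rw [hp.2.star_eq, hp.1.eq] at h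
  exact (Complex.nonneg_iff.mp h).1

variable [PartialOrder A] [StarOrderedRing A]

/-- The negative spectral projection of an invertible self-adjoint element. -/
theorem exists_negative_spectral_projection {s : A} (hs : IsSelfAdjoint s) (hsu : IsUnit s) :
    ∃ h : A, IsStarProjection h ∧ h * s ≤ 0 ∧ 0 ≤ (1 - h) * s ∧
      ∀ y : A, Commute s y → Commute h y := by
  have h0 : ∀ x ∈ spectrum ℝ s, x ≠ 0 := fun x hx hx0 =>
    spectrum.zero_notMem ℝ hsu (hx0 ▸ hx)
  let φ : ℝ → ℝ := fun x => if x < 0 then 1 else 0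
  have hφ : ContinuousOn φ (spectrum ℝ s) := by
    intro x hx
    apply ContinuousAt.continuousWithinAt
    rcases lt_or_gt_of_ne (h0 x hx) with h | h
    · exact continuousAt_const.congr (f := fun _ => (1 : ℝ))
        ((eventually_lt_nhds h).mono fun y hy => (if_pos hy).symm)
    · exact continuousAt_const.congr (f := fun _ => (0 : ℝ))
        ((eventually_gt_nhds h).mono fun y hy => (if_neg (not_lt_of_gt hy)).symm)
  have hφs : cfc φ s * s = cfc (fun x => φ x * x) s := by
    rw [cfc_mul φ (fun x => x) s, cfc_id' ℝ s]
  refine ⟨cfc φ s, ⟨?_, cfc_predicate φ s⟩, ?_, ?_, fun y hy => hy.cfc_real φ⟩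
  · change cfc φ s * cfc φ s = cfc φ s
    rw [← cfc_mul φ φ s]
    exact cfc_congr fun x _ => by simp [φ]
  · rw [hφs]
    refine cfc_nonpos _ _ fun x _ => ?_
    by_cases h : x < 0
    · simpa [φ, h] using h.le
    · simp [φ, h]
  · have : (1 - cfc φ s) * s = cfc (fun x => x - φ x * x) s := by
      rw [cfc_sub (fun x => x) (fun x => φ x * x) s, cfc_id' ℝ s, ← hφs, sub_mul, one_mul]
    rw [this]
    refine cfc_nonneg fun x _ => ?_
    by_cases h : x < 0
    · simp [φ, h]
    · simpa [φ, h] using not_lt.mp h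

/-- In real rank zero, a projection `f` splits as `g + k` along the spectral decomposition of
`f e f`, up to the precision needed to bound `g e g` above and `k e k` below. -/
theorem exists_projection_splitting
    (hRR0 : ∀ a : A, IsSelfAdjoint a → ∀ ε > (0:ℝ), ∃ b : A,
      IsSelfAdjoint b ∧ IsUnit b ∧ ‖a - b‖ < ε)
    {e f : A} (he : IsSelfAdjoint e) (hf : IsStarProjection f) {α β : ℝ} (hαβ : α < β) :
    ∃ g : A, IsStarProjection g ∧ IsStarProjection (f - g) ∧ g * e * g ≤ β • g ∧
      α • (f - g) ≤ (f - g) * e * (f - g) := by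
  obtain ⟨δ, hδ⟩ : ∃ δ, δ = (α + β) / 2 := ⟨_, rfl⟩
  obtain ⟨κ, hκ⟩ : ∃ κ, κ = (β - α) / 2 := ⟨_, rfl⟩
  have hκ0 : 0 < κ := by rw [hκ]; linarith
  have hff : f * f = f := hf.1
  have hx : IsSelfAdjoint (f * e * f - δ • f) := by
    refine IsSelfAdjoint.sub ?_ ((IsSelfAdjoint.all δ).smul hf.2)
    simpa [hf.2.star_eq] using he.conjugate f
  have hfx : f * (f * e * f - δ • f) * f = f * e * f - δ • f := by
    rw [mul_sub, sub_mul, mul_smul_comm, smul_mul_assoc, hff, hff]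
    simp only [← mul_assoc, hff]
    rw [mul_assoc, hff]
  obtain ⟨s, hs, hsu, hsf, hd⟩ := exists_isUnit_commute_norm_lt hRR0 hf hx hfx hκ0
  obtain ⟨d, hdd⟩ : ∃ d, d = f * s * f - (f * e * f - δ • f) := ⟨_, rfl⟩
  rw [← hdd] at hd
  have hds : IsSelfAdjoint d := by
    rw [hdd]
    refine IsSelfAdjoint.sub ?_ hx
    simpa [hf.2.star_eq] using hs.conjugate f
  have hd1 : d ≤ algebraMap ℝ A κ :=
    hds.le_algebraMap_norm_self.trans (algebraMap_mono A hd)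
  have hd2 : -algebraMap ℝ A κ ≤ d :=
    (neg_le_neg (algebraMap_mono A hd)).trans hds.neg_algebraMap_norm_le_self
  obtain ⟨h, hh, hhs, hhs', hcomm⟩ := exists_negative_spectral_projection hs hsu
  have hhf : Commute h f := hcomm f hsf
  have hsh : Commute h s := hcomm s (Commute.refl s)
  have hk : f - h * f = (1 - h) * f := by rw [sub_mul, one_mul]
  have hhf' : Commute (1 - h) f := (Commute.one_left f).sub_left hhf
  have hsh' : Commute (1 - h) s := (Commute.one_left s).sub_left hsh
  have formula : ∀ u : A, u * f = u → f * u = u → u * u = u →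
      u * e * u = δ • u + u * s * u - u * d * u := by
    intro u huf hfu huu
    have h1 : u * d * u = u * s * u - (u * e * u - δ • u) := by
      calc u * d * u = (u * f) * s * (f * u) - ((u * f) * e * (f * u) - δ • (u * f * u)) := by
            rw [hdd]
            simp only [mul_sub, sub_mul, mul_smul_comm, smul_mul_assoc, mul_assoc]
        _ = _ := by rw [huf, hfu, huu]
    rw [h1]; abel
  have sandwich : ∀ u : A, IsStarProjection u → u * f = u → f * u = u →
      u * d * u ≤ κ • u ∧ -(κ • u) ≤ u * d * u := by
    intro u hu huf hfu
    have hm : u * algebraMap ℝ A κ * u = κ • u := by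
      rw [Algebra.algebraMap_eq_smul_one, mul_smul_comm, mul_one, smul_mul_assoc, hu.1.eq]
    constructor
    · rw [← hm]; exact hu.2.conjugate_le_conjugate hd1
    · rw [← hm, ← neg_mul, ← mul_neg]; exact hu.2.conjugate_le_conjugate hd2
  have compress : ∀ u : A, IsStarProjection u → Commute u f → Commute u s →
      (u * f) * s * (u * f) = f * (u * s) * f := by
    intro u hu huf hus
    calc (u * f) * s * (u * f) = (f * u) * s * (u * f) := by rw [huf.eq]
      _ = f * (u * s * u) * f := by simp only [mul_assoc]
      _ = f * (u * s) * f := by rw [hus.eq, mul_assoc s u u, hu.1.eq]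
  have hgp : IsStarProjection (h * f) := hh.mul hf hhf
  have hkp : IsStarProjection ((1 - h) * f) := hh.one_sub.mul hf hhf'
  have hgf : h * f * f = h * f := by rw [mul_assoc, hff]
  have hfg : f * (h * f) = h * f := by rw [hhf.eq, ← mul_assoc, hff]
  have hkf : (1 - h) * f * f = (1 - h) * f := by rw [mul_assoc, hff]
  have hfk : f * ((1 - h) * f) = (1 - h) * f := by rw [hhf'.eq, ← mul_assoc, hff]
  refine ⟨h * f, hgp, hk ▸ hkp, ?_, ?_⟩
  · have h1 : h * f * s * (h * f) ≤ 0 := by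
      rw [compress h hh hhf hsh]
      simpa using hf.2.conjugate_le_conjugate hhs
    have h2 := (sandwich _ hgp hgf hfg).2
    rw [formula _ hgf hfg hgp.1]
    have hβ : β = δ + κ := by rw [hδ, hκ]; ring
    rw [hβ, add_smul]
    calc _ ≤ δ • (h * f) + 0 - -(κ • (h * f)) := by gcongr
      _ = _ := by abel
  · rw [hk]
    have h1 : 0 ≤ (1 - h) * f * s * ((1 - h) * f) := by
      rw [compress _ hh.one_sub hhf' hsh']
      simpa using hf.2.conjugate_le_conjugate hhs'
    have h2 := (sandwich _ hkp hkf hfk).1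
    rw [formula _ hkf hfk hkp.1]
    have hα : α = δ - κ := by rw [hδ, hκ]; ring
    rw [hα, sub_smul]
    calc _ = δ • ((1 - h) * f) + 0 - κ • ((1 - h) * f) := by abel
      _ ≤ _ := by gcongr

/-- A projection `k` on which the compression of `e` is bounded below is equivalent to a
subprojection of `e`, so its trace is at most that of `e`. -/
theorem IsTracialState.re_le_of_smul_le {τ : A →ₗ[ℂ] ℂ} (hτ : IsTracialState τ) {e k : A}
    (he : IsStarProjection e) (hk : IsStarProjection k) {α : ℝ} (hα : 0 < α)
    (hle : α • k ≤ k * e * k) : (τ k).re ≤ (τ e).re := by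
  have hkk : k * k = k := hk.1
  have hee : e * e = e := he.1
  obtain ⟨y, hy⟩ : ∃ y, y = k * e * k := ⟨_, rfl⟩
  have hyk : y * k = y := by rw [hy, mul_assoc, hkk]
  have hky : k * y = y := by rw [hy, ← mul_assoc, ← mul_assoc, hkk]
  have hys : star y = y := by
    rw [hy]; simp [hk.2.star_eq, he.2.star_eq, mul_assoc]
  have hz : IsUnit (y + α • (1 - k)) := by
    refine CStarAlgebra.isUnit_of_le (algebraMap ℝ A α) ?_ ?_
    · rw [Algebra.algebraMap_eq_smul_one, hy]
      calc α • (1 : A) = α • k + α • (1 - k) := by rw [← smul_add, add_sub_cancel]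
        _ ≤ _ := by gcongr
    · refine IsStrictlyPositive.iff_of_unital.mpr ⟨algebraMap_nonneg A hα.le, ?_⟩
      exact (IsUnit.mk0 α hα.ne').map (algebraMap ℝ A)
  obtain ⟨z, hz⟩ := hz
  have hzk : (z : A) * k = y := by
    rw [hz, add_mul, hyk, smul_mul_assoc, hk.one_sub_mul_self, smul_zero, add_zero]
  have hkz : k * (z : A) = y := by
    rw [hz, mul_add, hky, mul_smul_comm, hk.mul_one_sub_self, smul_zero, add_zero]
  have hzs : star (z : A) = z := by
    rw [hz]; simp [hys, hk.2.star_eq]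
  obtain ⟨r, hr⟩ : ∃ r : A, r = ↑z⁻¹ := ⟨_, rfl⟩
  have hrz : r * (z : A) = 1 := by rw [hr, Units.inv_mul]
  have hzr : (z : A) * r = 1 := by rw [hr, Units.mul_inv]
  have hyr : y * r = k := by rw [← hkz, mul_assoc, hzr, mul_one]
  have hrs : star r = r := by
    have h1 : (z : A) * star r = 1 := by
      have := congrArg star hrz
      simpa [hzs] using this
    calc star r = r * z * star r := by rw [hrz, one_mul]
      _ = r := by rw [mul_assoc, h1, mul_one]
  obtain ⟨u, hu⟩ : ∃ u, u = e * (k * r * k) * e := ⟨_, rfl⟩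
  have hup : IsStarProjection u := by
    constructor
    · change u * u = u
      calc u * u = e * k * r * (k * (e * e) * k) * r * k * e := by
            rw [hu]; simp only [mul_assoc]
        _ = e * k * r * (y * r) * k * e := by rw [hee, ← hy]; simp only [mul_assoc]
        _ = e * k * r * (k * k) * e := by rw [hyr]; simp only [mul_assoc]
        _ = u := by rw [hkk, hu]; simp only [mul_assoc]
    · change star u = u
      rw [hu]; simp [hrs, hk.2.star_eq, he.2.star_eq, mul_assoc]
  have hue : u * e = u := by rw [hu, mul_assoc, hee]
  have htu : τ u = τ k := by
    calc τ u = τ (e * (e * (k * r * k))) := by rw [hu]; exact hτ.2.2 _ _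
      _ = τ (e * (k * r) * k) := by rw [← mul_assoc, hee]; simp only [mul_assoc]
      _ = τ (k * (e * (k * r))) := hτ.2.2 _ _
      _ = τ (y * r) := by rw [hy]; simp only [mul_assoc]
      _ = τ k := by rw [hyr]
  have h := hτ.re_nonneg (hup.sub_of_mul_eq_left he hue)
  rw [map_sub, htu, Complex.sub_re] at h
  linarith

/-- A partial isometry `w` with `w* w = e` and range projection below `g` satisfies
`‖w²‖ ≤ ‖e g‖`. -/
theorem norm_mul_self_le_of_le_projection {e g w : A} (he : IsStarProjection e)
    (hg : IsStarProjection g) (hwe : star w * w = e) (hwg : w * star w ≤ g) :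
    ‖w * w‖ ≤ ‖e * g‖ := by
  have h1 : w * e = w := by
    have : star (w - w * e) * (w - w * e) = 0 := by
      have : star (w - w * e) * (w - w * e) =
          star w * w - star w * w * e - e * (star w * w) + e * (star w * w) * e := by
        simp only [star_sub, star_mul, he.2.star_eq, mul_sub, sub_mul, mul_assoc]; abel
      rw [this, hwe, he.1.eq, he.1.eq]; abel
    exact (sub_eq_zero.mp (CStarRing.star_mul_self_eq_zero_iff _ |>.mp this)).symm
  have h2 : g * w = w := by
    have h := (hg.mul_right_and_mul_left_of_nonneg_of_le (mul_star_self_nonneg w) hwg).2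
    have : (w - g * w) * star (w - g * w) = 0 := by
      have : (w - g * w) * star (w - g * w) =
          w * star w - g * (w * star w) - (w * star w - g * (w * star w)) * g := by
        simp only [star_sub, star_mul, hg.2.star_eq, mul_sub, sub_mul, mul_assoc]
      rw [this, h, sub_self, zero_mul, sub_self]
    exact (sub_eq_zero.mp (CStarRing.mul_star_self_eq_zero_iff _ |>.mp this)).symm
  have h3 : ‖w‖ ≤ 1 := by
    have h := CStarRing.norm_star_mul_self (x := w)
    rw [hwe] at h
    have := IsStarProjection.norm_le e he
    nlinarith [norm_nonneg w]
  calc ‖w * w‖ = ‖w * (e * g) * w‖ := by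
        rw [← mul_assoc, h1, mul_assoc, h2]
    _ ≤ ‖w‖ * ‖e * g‖ * ‖w‖ := norm_mul₃_le
    _ ≤ 1 * ‖e * g‖ * 1 := by gcongr
    _ = ‖e * g‖ := by ring

end

/-- Let `A` be a unital C*-algebra of real rank zero in which the order on
projections is determined by traces. If `e, f` are nonzero projections with `2 τ(e) < τ(f)`
for every tracial state `τ`, then for every `ε > 0` there is `w ∈ A` with `w* w = e`,
`w w* ≤ f` and `‖w²‖ < ε`. -/
theorem stmt1 {A : Type*} [CStarAlgebra A] [PartialOrder A] [StarOrderedRing A]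
    (hRR0 : ∀ a : A, IsSelfAdjoint a → ∀ ε > (0:ℝ), ∃ b : A,
      IsSelfAdjoint b ∧ IsUnit b ∧ ‖a - b‖ < ε)
    (hord : ∀ p q : A, IsProjection p → IsProjection q →
      (∀ τ : A →ₗ[ℂ] ℂ, IsTracialState τ → (τ p).re < (τ q).re) →
      ∃ w : A, star w * w = p ∧ w * star w ≤ q)
    (e f : A) (he : IsProjection e) (hf : IsProjection f) (he0 : e ≠ 0) (hf0 : f ≠ 0)
    (htr : ∀ τ : A →ₗ[ℂ] ℂ, IsTracialState τ → 2 * (τ e).re < (τ f).re)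
    (ε : ℝ) (hε : 0 < ε) :
    ∃ w : A, star w * w = e ∧ w * star w ≤ f ∧ ‖w * w‖ < ε := by
  have he' := he.isStarProjection
  have hf' := hf.isStarProjection
  obtain ⟨g, hg, hk, hge, hke⟩ := exists_projection_splitting hRR0 he'.2 hf'
    (show ε ^ 2 / 4 < ε ^ 2 / 2 by nlinarith [sq_pos_of_pos hε])
  have hgf : g ≤ f := sub_nonneg.mp hk.nonneg
  obtain ⟨w, hwe, hwg⟩ := hord e g he hg.isProjection fun τ hτ => by
    have h1 := hτ.re_le_of_smul_le he' hk (by positivity) hke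
    have h2 := htr τ hτ
    rw [map_sub, Complex.sub_re] at h1
    linarith
  refine ⟨w, hwe, hwg.trans hgf, (norm_mul_self_le_of_le_projection he' hg hwe hwg).trans_lt ?_⟩
  have hstar : star (e * g) * (e * g) = g * e * g := by
    rw [star_mul, he'.2.star_eq, hg.2.star_eq, mul_assoc, ← mul_assoc e e g, he'.1.eq, mul_assoc]
  have hle : g * e * g ≤ algebraMap ℝ A (ε ^ 2 / 2) := by
    refine hge.trans ?_
    rw [Algebra.algebraMap_eq_smul_one]
    gcongr
    exact sub_nonneg.mp hg.one_sub.nonneg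
  have hnorm : ‖g * e * g‖ ≤ ε ^ 2 / 2 :=
    (CStarAlgebra.norm_le_iff_le_algebraMap _ (by positivity)
      (hstar ▸ star_mul_self_nonneg (e * g))).mpr hle
  rw [← hstar, CStarRing.norm_star_mul_self] at hnorm
  nlinarith [norm_nonneg (e * g), sq_pos_of_pos hε]
end

section
/- Let m be a prime number, let g₀, g₁ : [0,1] → ℝ be continuous functions with g₀ · g₁ = 0 (pointwise product identically zero), and let l : ZMod m → Fin 2 be a function which is not constant. Define x ∈ C([0,1]^m, ℝ) by x(t) = Π_{j ∈ ZMod m} g_{l(j)}(t_j). Then for every i ∈ ZMod m with i ≠ 0, the function σ_m^i(x) · x is identically zero, where σ_m is the cyclic shift automorphism of C([0,1]^m, ℝ) and σ_m^i denotes its i-fold iterate (well defined modulo m). -/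
/-- The cyclic shift on functions on `[0,1]^m` (coordinates indexed by `ZMod m`):
`(σ_m f)(t) = f(s)` where `s j = t (j - 1)`. -/
def cyclicShift (m : ℕ) (f : (ZMod m → Set.Icc (0:ℝ) 1) → ℝ) :
    (ZMod m → Set.Icc (0:ℝ) 1) → ℝ :=
  fun t => f fun j => t (j - 1)

theorem cyclicShift_iterate (m n : ℕ) (f : (ZMod m → Set.Icc (0:ℝ) 1) → ℝ)
    (t : ZMod m → Set.Icc (0:ℝ) 1) :
    (cyclicShift m)^[n] f t = f fun j => t (j - n) := by
  induction n generalizing t with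
  | zero => simp
  | succ n ih =>
    rw [Function.iterate_succ_apply', cyclicShift, ih]
    congr 1
    funext j
    congr 1
    push_cast
    ring

/-- Every nonzero element of `ZMod p` generates it, so a function invariant under a nonzero
translation is constant. -/
theorem ZMod.eq_of_forall_add_eq {p : ℕ} [Fact p.Prime] {α : Type*} {f : ZMod p → α}
    {i : ZMod p} (hi : i ≠ 0) (h : ∀ k, f (k + i) = f k) (a b : ZMod p) : f a = f b := by
  have hmul : ∀ n : ℕ, f (b + n * i) = f b := by
    intro n
    induction n with
    | zero => simp
    | succ n ih =>
      rw [← ih, ← h (b + n * i)]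
      congr 1
      push_cast
      ring
  have key := hmul ((a - b) / i).val
  rwa [ZMod.natCast_zmod_val, div_mul_cancel₀ _ hi, add_sub_cancel] at key

/-- Let `m` be prime, `g₀ g₁ : [0,1] → ℝ` continuous with `g₀ ⬝ g₁ = 0`, and
`l : ZMod m → Fin 2` non-constant. Put `x t = ∏_{j ∈ ZMod m} g_{l j} (t j)`. Then for each
`i ∈ ZMod m`, `i ≠ 0`, the function `σ_m^i(x) ⬝ x` is identically zero. -/
theorem stmt4 (m : ℕ) [NeZero m] (hm : Nat.Prime m)
    (g : Fin 2 → C(Set.Icc (0:ℝ) 1, ℝ)) (hg : ∀ s, g 0 s * g 1 s = 0)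
    (l : ZMod m → Fin 2) (hl : ∃ a b : ZMod m, l a ≠ l b)
    (x : (ZMod m → Set.Icc (0:ℝ) 1) → ℝ)
    (hx : ∀ t, x t = ∏ j : ZMod m, g (l j) (t j))
    (i : ZMod m) (hi : i ≠ 0) :
    ∀ t, (cyclicShift m)^[i.val] x t * x t = 0 := by
  intro t
  have : Fact m.Prime := ⟨hm⟩
  obtain ⟨k, hk⟩ : ∃ k, l (k + i) ≠ l k := by
    by_contra! h
    obtain ⟨a, b, hab⟩ := hl
    exact hab (ZMod.eq_of_forall_add_eq hi h a b)
  have hzero : g (l (k + i)) (t k) * g (l k) (t k) = 0 := by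
    have hs := hg (t k)
    generalize l (k + i) = u at hk
    generalize l k = v at hk
    fin_cases u <;> fin_cases v <;> simp_all [or_comm]
  rw [cyclicShift_iterate, hx, hx, ZMod.natCast_zmod_val]
  rcases mul_eq_zero.mp hzero with h | h
  · exact mul_eq_zero_of_left (Finset.prod_eq_zero (Finset.mem_univ (k + i)) (by simpa using h)) _
  · exact mul_eq_zero_of_right _ (Finset.prod_eq_zero (Finset.mem_univ k) h)
end

section
/- Let μ be a faithful Borel probability measure on [0,1]. Then there exist a constant c < 1 and sequences (g_n⁰)_{n∈ℕ} and (g_n¹)_{n∈ℕ} of continuous functions [0,1] → [0,1] such that: each g_n⁰ and each g_n¹ is not identically zero; g_n⁰ · g_n¹ = 0 (pointwise) for every n; ∫ (g_n⁰ + g_n¹) dμ → 1 as n → ∞; and ∫ g_n^l dμ ≤ c for every n ∈ ℕ and l ∈ {0,1}. -/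
open MeasureTheory Filter

/-- The truncation `min 1 ((n + 1) f⁺)`, increasing in `n` to the indicator of `{f > 0}`. -/
noncomputable def ramp {X : Type*} [TopologicalSpace X] (f : C(X, ℝ)) (n : ℕ) : C(X, ℝ) where
  toFun x := min 1 ((n + 1) * max 0 (f x))

section Ramp

variable {X : Type*} [TopologicalSpace X] (f : C(X, ℝ)) (n : ℕ) (x : X)

theorem ramp_apply : ramp f n x = min 1 ((n + 1) * max 0 (f x)) := rfl

theorem ramp_nonneg : 0 ≤ ramp f n x := by
  rw [ramp_apply]; positivity

theorem ramp_le_one : ramp f n x ≤ 1 := min_le_left _ _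

theorem ramp_zero_le : ramp f 0 x ≤ ramp f n x := by
  simp only [ramp_apply]
  gcongr
  simp

variable {f x}

theorem ramp_pos (h : 0 < f x) : 0 < ramp f n x := by
  rw [ramp_apply, max_eq_right h.le]; positivity

theorem ramp_of_nonpos (h : f x ≤ 0) : ramp f n x = 0 := by
  simp [ramp_apply, max_eq_left h]

theorem ramp_mul_ramp_neg : ramp f n x * ramp (-f) n x = 0 := by
  rcases le_total (f x) 0 with h | h
  · rw [ramp_of_nonpos n h, zero_mul]
  · rw [ramp_of_nonpos (f := -f) n (by simpa using h), mul_zero]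

theorem ramp_add_ramp_neg_le_one : ramp f n x + ramp (-f) n x ≤ 1 := by
  rcases le_total (f x) 0 with h | h
  · rw [ramp_of_nonpos n h, zero_add]; exact ramp_le_one _ _ _
  · rw [ramp_of_nonpos (f := -f) n (by simpa using h), add_zero]; exact ramp_le_one _ _ _

theorem tendsto_ramp (h : 0 < f x) : Tendsto (fun n => ramp f n x) atTop (nhds 1) := by
  apply tendsto_const_nhds.congr'
  obtain ⟨N, hN⟩ := exists_nat_gt (1 / f x)
  filter_upwards [eventually_ge_atTop N] with n hn
  have hn' : (N : ℝ) ≤ n := by exact_mod_cast hn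
  rw [div_lt_iff₀ h] at hN
  rw [ramp_apply, max_eq_right h.le, min_eq_left]
  nlinarith

theorem tendsto_ramp_add_ramp_neg (h : f x ≠ 0) :
    Tendsto (fun n => ramp f n x + ramp (-f) n x) atTop (nhds 1) := by
  rcases h.lt_or_gt with h | h
  · simpa [ramp_of_nonpos _ h.le] using tendsto_ramp (f := -f) (x := x) (by simpa using h)
  · have h' : (-f) x ≤ 0 := by simpa using h.le
    simpa [ramp_of_nonpos _ h'] using tendsto_ramp h

end Ramp

theorem exists_mem_Ioo_measure_singleton_eq_zero (μ : Measure (Set.Icc (0 : ℝ) 1))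
    [IsProbabilityMeasure μ] :
    ∃ t : Set.Icc (0 : ℝ) 1, (0 : ℝ) < t ∧ (t : ℝ) < 1 ∧ μ {t} = 0 := by
  have hc : {x : Set.Icc (0 : ℝ) 1 | 0 < μ {x}}.Countable :=
    Measure.countable_meas_pos_of_disjoint_iUnion (fun x => measurableSet_singleton x)
      fun x y h => by simpa using h
  have hd := (hc.image Subtype.val).dense_compl ℝ
  obtain ⟨t, ht, h0, h1⟩ := hd.exists_between (zero_lt_one' ℝ)
  refine ⟨⟨t, h0.le, h1.le⟩, h0, h1, ?_⟩
  by_contra hne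
  exact ht ⟨_, pos_iff_ne_zero.mpr hne, rfl⟩

/-- Let `μ` be a faithful Borel probability measure on `[0,1]`. Then there exist
`c < 1` and sequences `(g n 0)`, `(g n 1)` of continuous functions `[0,1] → [0,1]`, none
identically zero, with `g n 0 ⬝ g n 1 = 0` pointwise, `∫ (g n 0 + g n 1) dμ → 1`, and
`∫ g n l dμ ≤ c` for all `n` and `l ∈ {0,1}`. -/
theorem stmt5 (μ : Measure (Set.Icc (0:ℝ) 1)) [IsProbabilityMeasure μ]
    (hfaith : ∀ f : C(Set.Icc (0:ℝ) 1, ℝ), (∀ x, 0 ≤ f x) → ∫ x, f x ∂μ = 0 → f = 0) :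
    ∃ (c : ℝ) (g : ℕ → Fin 2 → C(Set.Icc (0:ℝ) 1, ℝ)),
      c < 1 ∧
      (∀ n i, ∀ x, g n i x ∈ Set.Icc (0:ℝ) 1) ∧
      (∀ n i, g n i ≠ 0) ∧
      (∀ n x, g n 0 x * g n 1 x = 0) ∧
      Tendsto (fun n => ∫ x, (g n 0 x + g n 1 x) ∂μ) atTop (nhds 1) ∧
      (∀ n i, ∫ x, g n i x ∂μ ≤ c) := by
  obtain ⟨t, ht0, ht1, hμt⟩ := exists_mem_Ioo_measure_singleton_eq_zero μ
  let f : C(Set.Icc (0:ℝ) 1, ℝ) := ⟨fun x => x - t, by fun_prop⟩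
  have hint : ∀ h : C(Set.Icc (0:ℝ) 1, ℝ), Integrable h μ := fun h =>
    h.continuous.integrable_of_hasCompactSupport (HasCompactSupport.of_compactSpace _)
  have hne : ∀ n, ramp f n ≠ 0 := fun n h => by
    have := ramp_pos (f := f) (x := 1) n (by simpa [f] using ht1)
    simp [h] at this
  have hne' : ∀ n, ramp (-f) n ≠ 0 := fun n h => by
    have := ramp_pos (f := -f) (x := 0) n (by simpa [f] using ht0)
    simp [h] at this
  have hpos : ∀ h : C(Set.Icc (0:ℝ) 1, ℝ), ramp h 0 ≠ 0 → 0 < ∫ x, ramp h 0 x ∂μ :=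
    fun h hh => (integral_nonneg (ramp_nonneg h 0)).lt_of_ne' fun h0 =>
      hh (hfaith _ (ramp_nonneg h 0) h0)
  have hsum : ∀ n, ∫ x, ramp f n x ∂μ + ∫ x, ramp (-f) n x ∂μ ≤ 1 := fun n => by
    rw [← integral_add (hint _) (hint _)]
    simpa using integral_mono ((hint (ramp f n)).add (hint (ramp (-f) n)))
      (integrable_const (1 : ℝ)) fun x => ramp_add_ramp_neg_le_one n
  have hmono : ∀ (h : C(Set.Icc (0:ℝ) 1, ℝ)) n, ∫ x, ramp h 0 x ∂μ ≤ ∫ x, ramp h n x ∂μ :=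
    fun h n => integral_mono (hint _) (hint _) (ramp_zero_le h n)
  refine ⟨max (1 - ∫ x, ramp f 0 x ∂μ) (1 - ∫ x, ramp (-f) 0 x ∂μ),
    fun n => ![ramp f n, ramp (-f) n], ?_, ?_, ?_, fun n x => ramp_mul_ramp_neg n, ?_, ?_⟩
  · exact max_lt (by linarith [hpos f (hne 0)]) (by linarith [hpos (-f) (hne' 0)])
  · intro n i x
    fin_cases i
    · exact ⟨ramp_nonneg f n x, ramp_le_one f n x⟩
    · exact ⟨ramp_nonneg (-f) n x, ramp_le_one (-f) n x⟩
  · intro n i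
    fin_cases i
    · exact hne n
    · exact hne' n
  · have hlim : ∀ᵐ x ∂μ,
        Tendsto (fun n => ramp f n x + ramp (-f) n x) atTop (nhds 1) := by
      filter_upwards [measure_eq_zero_iff_ae_notMem.mp hμt] with x hx
      refine tendsto_ramp_add_ramp_neg fun h => hx ?_
      exact Subtype.ext (sub_eq_zero.mp h)
    have := tendsto_integral_of_dominated_convergence (fun _ => (1 : ℝ))
      (fun n => ((hint (ramp f n)).add (hint (ramp (-f) n))).aestronglyMeasurable)
      (integrable_const 1)
      (fun n => ae_of_all _ fun x => by
        simpa only [Pi.add_apply, Real.norm_eq_abs,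
          abs_of_nonneg (add_nonneg (ramp_nonneg f n x) (ramp_nonneg (-f) n x))]
          using ramp_add_ramp_neg_le_one n) hlim
    simpa using this
  · intro n i
    fin_cases i
    · exact le_max_of_le_right (by
        simpa using (by linarith [hsum n, hmono (-f) n] :
          ∫ x, ramp f n x ∂μ ≤ 1 - ∫ x, ramp (-f) 0 x ∂μ))
    · exact le_max_of_le_left (by
        simpa using (by linarith [hsum n, hmono f n] :
          ∫ x, ramp (-f) n x ∂μ ≤ 1 - ∫ x, ramp f 0 x ∂μ))
end

section
/- Let g, p, q, k be natural numbers with g ≥ 1, p ≥ 1, q ≥ 1, gcd(p, q) = 1, and k > g·(p + q). Then there exist natural numbers k₀, k₁, r₀, r₁ such that: gcd(k₀, q) = 1, k₀ ≡ 1 (mod g), and k₀ > k; gcd(k₁, p·k₀) = 1, k₁ ≡ 1 (mod g), and k₁ > k₀; gcd(p·k₀, q·k₁) = 1; 0 < r₀ ≤ g·q·k₁ and k₀·k₁ ≡ r₀ (mod g·q·k₁); 0 < r₁ ≤ g·p·k₀ and k₀·k₁ ≡ r₁ (mod g·p·k₀); r₀ ≡ 1 (mod g) and r₁ ≡ 1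 (mod g); k₁ divides r₀ and k₀ divides r₁; and k₀·k₁ > r₀ + r₁. -/
/-- Elementary number-theoretic construction of `k₀, k₁, r₀, r₁`
(cf. Lemma 2.1 of the paper). -/
theorem stmt8 (g p q k : ℕ) (hg : 1 ≤ g) (hp : 1 ≤ p) (hq : 1 ≤ q)
    (hpq : Nat.gcd p q = 1) (hk : g * (p + q) < k) :
    ∃ k₀ k₁ r₀ r₁ : ℕ,
      Nat.gcd k₀ q = 1 ∧ k₀ ≡ 1 [MOD g] ∧ k < k₀ ∧
      Nat.gcd k₁ (p * k₀) = 1 ∧ k₁ ≡ 1 [MOD g] ∧ k₀ < k₁ ∧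
      Nat.gcd (p * k₀) (q * k₁) = 1 ∧
      (0 < r₀ ∧ r₀ ≤ g * q * k₁ ∧ k₀ * k₁ ≡ r₀ [MOD g * q * k₁]) ∧
      (0 < r₁ ∧ r₁ ≤ g * p * k₀ ∧ k₀ * k₁ ≡ r₁ [MOD g * p * k₀]) ∧
      r₀ ≡ 1 [MOD g] ∧ r₁ ≡ 1 [MOD g] ∧
      k₁ ∣ r₀ ∧ k₀ ∣ r₁ ∧ r₀ + r₁ < k₀ * k₁ := by
  have hgq : 1 ≤ g * q := Nat.mul_pos hg hq
  have hgp : 1 ≤ g * p := Nat.mul_pos hg hp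
  have hk_pos : 1 ≤ k := by lia
  obtain ⟨a, ha⟩ : ∃ a, a = 1 + g * q * k := ⟨_, rfl⟩
  obtain ⟨b, hb⟩ : ∃ b, b = 1 + g * p * a := ⟨_, rfl⟩
  have hka : k < a := by nlinarith
  have hab : a < b := by nlinarith
  have haq : a.Coprime q := by
    rw [ha, show 1 + g * q * k = 1 + q * (g * k) by ring]
    simp
  have hbpa : b.Coprime (p * a) := by
    rw [hb, show 1 + g * p * a = 1 + p * a * g by ring]
    simp
  have hag : a ≡ 1 [MOD g] := by
    rw [ha, mul_assoc]
    simp [Nat.ModEq]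
  have hbg : b ≡ 1 [MOD g] := by
    rw [hb, mul_assoc]
    simp [Nat.ModEq]
  have hagq : a ≡ 1 [MOD g * q] := by
    rw [ha]
    simp [Nat.ModEq]
  have hbgp : b ≡ 1 [MOD g * p] := by
    rw [hb]
    simp [Nat.ModEq]
  refine ⟨a, b, b, a, haq, hag, hka, hbpa, hbg, hab, ?_,
    ⟨by lia, Nat.le_mul_of_pos_left b hgq, ?_⟩,
    ⟨by lia, Nat.le_mul_of_pos_left a hgp, ?_⟩, hbg, hag, dvd_rfl, dvd_rfl, ?_⟩
  · exact Nat.Coprime.mul_right (Nat.Coprime.mul_left hpq haq) hbpa.symm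
  · simpa using hagq.mul_right' b
  · simpa [mul_comm b a] using hbgp.mul_right' a
  · have : 2 ≤ p + q := by lia
    have : 2 ≤ g * (p + q) := by nlinarith
    nlinarith
end

section
/- Let A be a unital C*-algebra, τ a tracial state on A, d ≥ 1 a natural number, and (e_{ij})_{i,j ∈ Fin d} a system of matrix units of size d in A. Define Φ : A → A by Φ(a) = d^{−1} Σ_{i,j ∈ Fin d} e_{ij} · a · e_{ji}. Then for every a ∈ A, ‖Φ(a) − a‖₂ ≤ d^{−1} Σ_{i,j ∈ Fin d} ‖a·e_{ij} − e_{ij}·a‖₂. -/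
open scoped ComplexOrder

/-- A system of matrix units of size `d` in a unital C*-algebra. -/
def IsMatrixUnits {A : Type*} [CStarAlgebra A] (d : ℕ) (e : Fin d → Fin d → A) : Prop :=
  (∀ i j k l, e i j * e k l = if j = k then e i l else 0) ∧
  (∀ i j, star (e i j) = e j i) ∧
  (∑ i, e i i = 1)

/-- The trace 2-seminorm `‖x‖₂ = (Re τ(x* x))^{1/2}` associated with a functional `τ`. -/
noncomputable def traceSeminorm {A : Type*} [CStarAlgebra A] (τ : A →ₗ[ℂ] ℂ) (x : A) : ℝ :=
  Real.sqrt (τ (star x * x)).re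

/-- The conditional expectation `Φ(a) = d⁻¹ ∑_{i,j} e_{ij} a e_{ji}` associated with a system of
matrix units. -/
noncomputable def matrixUnitsExpectation {A : Type*} [CStarAlgebra A] (d : ℕ)
    (e : Fin d → Fin d → A) (a : A) : A :=
  (d : ℂ)⁻¹ • ∑ i, ∑ j, e i j * a * e j i

/-- A functional that is nonnegative on all `star x * x` is hermitian on products. -/
theorem map_star_mul_comm_of_nonneg {A : Type*} [CStarAlgebra A] (τ : A →ₗ[ℂ] ℂ)
    (hτ : ∀ a : A, 0 ≤ τ (star a * a)) (x y : A) :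
    (starRingEnd ℂ) (τ (star y * x)) = τ (star x * y) := by
  have him (a : A) : (τ (star a * a)).im = 0 := (Complex.nonneg_iff.mp (hτ a)).2.symm
  have h₁ := him (x + y)
  have h₂ := him (x + Complex.I • y)
  simp only [star_add, star_smul, add_mul, mul_add, map_add, smul_mul_assoc, mul_smul_comm,
    map_smul, Complex.add_im, him, smul_eq_mul, Complex.mul_im, Complex.mul_re, Complex.I_re,
    Complex.I_im, RCLike.star_def, Complex.conj_I, Complex.neg_re, Complex.neg_im] at h₁ h₂
  apply Complex.ext
  · simp only [Complex.conj_re]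
    linarith
  · simp only [Complex.conj_im]
    linarith

/-- The sesquilinear form `⟪x, y⟫ = τ (star x * y)` of a positive functional. -/
noncomputable abbrev traceCore {A : Type*} [CStarAlgebra A] (τ : A →ₗ[ℂ] ℂ)
    (hτ : ∀ a : A, 0 ≤ τ (star a * a)) : PreInnerProductSpace.Core ℂ A where
  inner x y := τ (star x * y)
  conj_inner_symm x y := map_star_mul_comm_of_nonneg τ hτ x y
  re_inner_nonneg x := (Complex.nonneg_iff.mp (hτ x)).1
  add_left x y z := by simp [add_mul]
  smul_left x y r := by simp

/-- `traceSeminorm` of a positive functional, bundled as a seminorm. -/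
noncomputable def traceSeminormBundled {A : Type*} [CStarAlgebra A] (τ : A →ₗ[ℂ] ℂ)
    (hτ : ∀ a : A, 0 ≤ τ (star a * a)) : Seminorm ℂ A :=
  letI c := traceCore τ hτ
  @normSeminorm ℂ A _ (InnerProductSpace.Core.toSeminormedAddCommGroup (c := c))
    (InnerProductSpace.Core.toNormedSpace (c := c))

theorem traceSeminorm_mul_matrixUnit_le {A : Type*} [CStarAlgebra A] {τ : A →ₗ[ℂ] ℂ}
    (hτ : IsTracialState τ) {d : ℕ} {e : Fin d → Fin d → A} (he : IsMatrixUnits d e)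
    (x : A) (i j : Fin d) : traceSeminorm τ (x * e i j) ≤ traceSeminorm τ x := by
  obtain ⟨-, hpos, htr⟩ := hτ
  obtain ⟨hmul, hstar, -⟩ := he
  have hii : e i i * e i i = e i i := by simp [hmul]
  have h₁ : τ (star (x * e i j) * (x * e i j)) = τ (star x * x * e i i) := by
    rw [star_mul, hstar, mul_assoc, htr, mul_assoc, mul_assoc, hmul, if_pos rfl, mul_assoc]
  have h₂ : τ (star (x * (1 - e i i)) * (x * (1 - e i i)))
      = τ (star x * x) - τ (star x * x * e i i) := by
    have hproj : (1 - e i i) * (1 - e i i) = 1 - e i i := by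
      simp [mul_sub, sub_mul, hii]
    rw [star_mul, star_sub, star_one, hstar, mul_assoc, htr, mul_assoc, mul_assoc, hproj,
      ← mul_assoc, mul_sub, mul_one, map_sub]
  refine Real.sqrt_le_sqrt ?_
  have h := (Complex.nonneg_iff.mp (hpos (x * (1 - e i i)))).1
  rw [h₂, Complex.sub_re] at h
  rw [h₁]
  linarith

theorem matrixUnitsExpectation_sub {A : Type*} [CStarAlgebra A] {d : ℕ} (hd : 1 ≤ d)
    {e : Fin d → Fin d → A} (he : IsMatrixUnits d e) (a : A) :
    matrixUnitsExpectation d e a - a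
      = (d : ℂ)⁻¹ • ∑ i, ∑ j, -((a * e i j - e i j * a) * e j i) := by
  obtain ⟨hmul, -, hone⟩ := he
  have hd₀ : (d : ℂ) ≠ 0 := by exact_mod_cast (by lia : d ≠ 0)
  have hsum : ∑ i, ∑ j, a * e i j * e j i = (d : ℂ) • a := by
    simp [mul_assoc, hmul, ← Finset.mul_sum, hone, Nat.cast_smul_eq_nsmul]
  simp only [sub_mul, neg_sub, Finset.sum_sub_distrib, hsum, smul_sub, inv_smul_smul₀ hd₀]
  rfl

/-- For a tracial state `τ`, a system of matrix units `(e_{ij})` of size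
`d ≥ 1`, and the expectation `Φ(a) = d⁻¹ ∑ e_{ij} a e_{ji}`, one has
`‖Φ(a) − a‖₂ ≤ d⁻¹ ∑_{i,j} ‖a e_{ij} − e_{ij} a‖₂`. -/
theorem stmt10 {A : Type*} [CStarAlgebra A] (τ : A →ₗ[ℂ] ℂ) (hτ : IsTracialState τ)
    (d : ℕ) (hd : 1 ≤ d) (e : Fin d → Fin d → A) (he : IsMatrixUnits d e) (a : A) :
    traceSeminorm τ (matrixUnitsExpectation d e a - a)
      ≤ (d : ℝ)⁻¹ * ∑ i, ∑ j, traceSeminorm τ (a * e i j - e i j * a) := by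
  set p := traceSeminormBundled τ hτ.2.1
  change p _ ≤ _
  rw [matrixUnitsExpectation_sub hd he, map_smul_eq_mul, norm_inv, Complex.norm_natCast]
  gcongr
  refine (Finset.le_sum_of_subadditive p (map_zero p).le (map_add_le_add p) _ _).trans ?_
  gcongr with i
  refine (Finset.le_sum_of_subadditive p (map_zero p).le (map_add_le_add p) _ _).trans ?_
  gcongr with j
  rw [map_neg_eq_map]
  exact traceSeminorm_mul_matrixUnit_le hτ he _ j i
end

section
/- Let A be a unital C*-algebra, u ∈ A a unitary, q ∈ A a projection, N ≥ 1 a natural number, and ε₁ > 0. Suppose that the projections u^j·q·u^{−j}, j = 0, 1, …, N−1, are mutually orthogonal (i.e., (u^i·q·u^{−i})·(u^j·q·u^{−j}) = 0 for i ≠ j in {0,…,N−1}). Let w' ∈ A be such that e := w'*·w' is a projection, w'·w'* ≤ q, and ‖e·u^j − u^j·e‖ < ε₁ for j = 1, …, N−1. Set w := N^{−1/2} Σ_{j=0}^{N−1} u^j·w'·u^{−j}. Then ‖w·u − u·w‖ ≤ 2·N^{−1/2} and ‖w*·w − e‖ < ε₁. -/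
open Finset in
/-- The commutator of `u` with the sum of the conjugates of `a` by powers of `u` telescopes. -/
theorem sum_conj_pow_commutator {A : Type*} [Ring A] [StarRing A] {u : A}
    (hu : star u * u = 1) (a : A) (N : ℕ) :
    (∑ j ∈ range N, u ^ j * a * star u ^ j) * u - u * ∑ j ∈ range N, u ^ j * a * star u ^ j =
      (a - u ^ N * a * star u ^ N) * u := by
  have h : ∀ j, u * (u ^ j * a * star u ^ j) = u ^ (j + 1) * a * star u ^ (j + 1) * u := by
    intro j
    rw [pow_succ (star u), pow_succ' u]
    simp only [mul_assoc, hu, mul_one]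
  rw [mul_sum, sum_congr rfl fun j _ => h j, ← sum_mul, ← sub_mul, ← sum_sub_distrib,
    sum_range_sub' fun j => u ^ j * a * star u ^ j]
  simp

/-- If `star a * a` is idempotent, then `a` is a contraction. -/
theorem norm_le_one_of_isIdempotentElem_star_mul_self {A : Type*} [NormedRing A] [StarRing A]
    [CStarRing A] {a : A} (h : IsIdempotentElem (star a * a)) : ‖a‖ ≤ 1 := by
  have h1 : ‖star a * a‖ = ‖a‖ * ‖a‖ := CStarRing.norm_star_mul_self
  have h2 : ‖star (star a * a) * (star a * a)‖ = ‖star a * a‖ * ‖star a * a‖ :=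
    CStarRing.norm_star_mul_self
  rw [star_mul, star_star, h.eq, h1] at h2
  by_contra! hlt
  nlinarith [mul_pos (sub_pos.2 hlt) (by linarith : 0 < ‖a‖)]

/-- If `a * star a` lies below a projection `q`, then `q` is a left unit for `a`. -/
theorem IsStarProjection.mul_eq_of_mul_star_le {A : Type*} [CStarAlgebra A] [PartialOrder A]
    [StarOrderedRing A] {q a : A} (hq : IsStarProjection q) (h : a * star a ≤ q) :
    q * a = a := by
  have hle := star_right_conjugate_le_conjugate h (1 - q)
  have hz : (1 - q) * q = 0 := by rw [sub_mul, one_mul, hq.isIdempotentElem.eq, sub_self]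
  rw [hz, zero_mul] at hle
  have heq : (1 - q) * (a * star a) * star (1 - q) = ((1 - q) * a) * star ((1 - q) * a) := by
    simp only [star_mul, mul_assoc]
  rw [heq] at hle
  have h0 := CStarRing.mul_star_self_eq_zero_iff _ |>.1 (hle.antisymm (mul_star_self_nonneg _))
  rw [sub_mul, one_mul, sub_eq_zero] at h0
  exact h0.symm

open Finset in
/-- If the conjugates of `q` by the powers of the unitary `u` are mutually orthogonal and `q` is a
left unit for `a`, then the cross terms in `star S * S` vanish, where `S` is the sum of the
conjugates of `a`. -/
theorem star_sum_conj_pow_mul_self {A : Type*} [Ring A] [StarRing A] {u q a : A}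
    (hu : star u * u = 1) (hq : star q = q) (hqa : q * a = a) {N : ℕ}
    (horth : ∀ i j : ℕ, i < N → j < N → i ≠ j →
      (u ^ i * q * star u ^ i) * (u ^ j * q * star u ^ j) = 0) :
    star (∑ j ∈ range N, u ^ j * a * star u ^ j) * ∑ j ∈ range N, u ^ j * a * star u ^ j =
      ∑ j ∈ range N, u ^ j * (star a * a) * star u ^ j := by
  have hpow : ∀ j, star u ^ j * u ^ j = 1 := fun j => pow_mul_pow_eq_one j hu
  have hl : ∀ j, u ^ j * q * star u ^ j * (u ^ j * a * star u ^ j) = u ^ j * a * star u ^ j := by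
    intro j
    calc _ = u ^ j * (q * (star u ^ j * u ^ j) * a) * star u ^ j := by simp only [mul_assoc]
      _ = _ := by rw [hpow, mul_one, hqa]
  have hs : ∀ j, star (u ^ j * q * star u ^ j) = u ^ j * q * star u ^ j := by
    intro j
    simp only [star_mul, star_pow, star_star, hq, mul_assoc]
  rw [star_sum, sum_mul_sum]
  refine sum_congr rfl fun i hi => ?_
  rw [sum_eq_single_of_mem i hi]
  · calc _ = u ^ i * (star a * (star u ^ i * u ^ i) * a) * star u ^ i := by
          simp only [star_mul, star_pow, star_star, mul_assoc]
      _ = _ := by rw [hpow, mul_one]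
  · intro j hj hji
    rw [← hl i, ← hl j, star_mul, hs, mul_assoc, ← mul_assoc (u ^ i * q * star u ^ i),
      horth i j (mem_range.1 hi) (mem_range.1 hj) hji.symm, zero_mul, mul_zero]


/-- Averaging a partial isometry along orbits of a unitary: if
`u^j q u^{-j}`, `j = 0, …, N−1`, are mutually orthogonal projections, `w'` satisfies that
`e := w'* w'` is a projection, `w' w'* ≤ q`, and `‖e u^j − u^j e‖ < ε₁` for `1 ≤ j ≤ N−1`,
then `w := N^{−1/2} ∑_{j<N} u^j w' u^{−j}` satisfies `‖w u − u w‖ ≤ 2 N^{−1/2}` and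
`‖w* w − e‖ < ε₁`. -/
theorem stmt12 {A : Type*} [CStarAlgebra A] [PartialOrder A] [StarOrderedRing A]
    (u q : A) (hu : star u * u = 1) (hu' : u * star u = 1)
    (hq : star q = q ∧ q * q = q)
    (N : ℕ) (hN : 1 ≤ N) (ε₁ : ℝ) (hε₁ : 0 < ε₁)
    (horth : ∀ i j : ℕ, i < N → j < N → i ≠ j →
      (u ^ i * q * (star u) ^ i) * (u ^ j * q * (star u) ^ j) = 0)
    (w' : A) (hw'proj : (star w' * w') * (star w' * w') = star w' * w')
    (hw'q : w' * star w' ≤ q)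
    (hcomm : ∀ j : ℕ, 1 ≤ j → j < N →
      ‖(star w' * w') * u ^ j - u ^ j * (star w' * w')‖ < ε₁) :
    ‖((Real.sqrt N : ℂ)⁻¹ • ∑ j ∈ Finset.range N, u ^ j * w' * (star u) ^ j) * u
        - u * ((Real.sqrt N : ℂ)⁻¹ • ∑ j ∈ Finset.range N, u ^ j * w' * (star u) ^ j)‖
      ≤ 2 * (Real.sqrt N)⁻¹ ∧
    ‖star ((Real.sqrt N : ℂ)⁻¹ • ∑ j ∈ Finset.range N, u ^ j * w' * (star u) ^ j)
        * ((Real.sqrt N : ℂ)⁻¹ • ∑ j ∈ Finset.range N, u ^ j * w' * (star u) ^ j)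
        - star w' * w'‖ < ε₁ := by
  have hum : u ∈ unitary A := Unitary.mem_iff.2 ⟨hu, hu'⟩
  have hpm : ∀ j, u ^ j ∈ unitary A := fun j => pow_mem hum j
  have hsm : ∀ j, star u ^ j ∈ unitary A := fun j => pow_mem (Unitary.star_mem hum) j
  have hN0 : (0 : ℝ) < N := by exact_mod_cast hN
  have hnorm : ‖(Real.sqrt N : ℂ)⁻¹‖ = (Real.sqrt N)⁻¹ := by
    rw [norm_inv, Complex.norm_real, Real.norm_of_nonneg (Real.sqrt_nonneg _)]
  constructor
  · have hw := norm_le_one_of_isIdempotentElem_star_mul_self hw'proj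
    rw [smul_mul_assoc, mul_smul_comm, ← smul_sub, sum_conj_pow_commutator hu, norm_smul, hnorm,
      CStarRing.norm_mul_mem_unitary _ hum, mul_comm]
    gcongr
    calc _ ≤ ‖w'‖ + ‖u ^ N * w' * star u ^ N‖ := norm_sub_le _ _
      _ = ‖w'‖ + ‖w'‖ := by
        rw [CStarRing.norm_mul_mem_unitary _ (hsm N), CStarRing.norm_mem_unitary_mul _ (hpm N)]
      _ ≤ 2 := by linarith
  · have hqw := IsStarProjection.mul_eq_of_mul_star_le ⟨hq.2, hq.1⟩ hw'q
    have hscal : star (Real.sqrt N : ℂ)⁻¹ * (Real.sqrt N : ℂ)⁻¹ = (N : ℂ)⁻¹ := by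
      rw [star_inv₀, Complex.star_def, Complex.conj_ofReal, ← mul_inv, ← Complex.ofReal_mul,
        Real.mul_self_sqrt hN0.le, Complex.ofReal_natCast]
    have hNC : (N : ℂ) ≠ 0 := by exact_mod_cast hN0.ne'
    rw [star_smul, smul_mul_smul_comm, hscal, star_sum_conj_pow_mul_self hu hq.1 hqw horth]
    set e := star w' * w'
    have hterm : ∀ j, ‖u ^ j * e * star u ^ j - e‖ = ‖e * u ^ j - u ^ j * e‖ := by
      intro j
      rw [← CStarRing.norm_mul_mem_unitary (u ^ j * e * star u ^ j - e) (hpm j), sub_mul,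
        mul_assoc (u ^ j * e), pow_mul_pow_eq_one j hu, mul_one, norm_sub_rev]
    have hlt : ∀ j ∈ Finset.range N, ‖u ^ j * e * star u ^ j - e‖ < ε₁ := by
      intro j hj
      rcases Nat.eq_zero_or_pos j with rfl | hj0
      · simpa using hε₁
      · rw [hterm]
        exact hcomm j hj0 (Finset.mem_range.1 hj)
    have havg : (N : ℂ)⁻¹ • ∑ j ∈ Finset.range N, u ^ j * e * star u ^ j - e =
        (N : ℂ)⁻¹ • ∑ j ∈ Finset.range N, (u ^ j * e * star u ^ j - e) := by
      rw [Finset.sum_sub_distrib, Finset.sum_const, Finset.card_range, smul_sub,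
        ← Nat.cast_smul_eq_nsmul ℂ N e, inv_smul_smul₀ hNC]
    rw [havg, norm_smul, norm_inv, Complex.norm_natCast, inv_mul_lt_iff₀ hN0]
    calc _ ≤ ∑ j ∈ Finset.range N, ‖u ^ j * e * star u ^ j - e‖ := norm_sum_le _ _
      _ < ∑ j ∈ Finset.range N, ε₁ :=
        Finset.sum_lt_sum_of_nonempty (Finset.nonempty_range_iff.2 (by omega)) hlt
      _ = N * ε₁ := by simp
end

section
/- Let A be a unital C*-algebra, let φ be a state on A, and let x ∈ A with ‖x‖ ≤ 1. Then ‖|x| − 1‖₂ ≤ ‖x*·x − 1‖₂^{1/2}, where |x| = (x*·x)^{1/2} is the positive square root of x*·x and ‖y‖₂ = (Re φ(y*·y))^{1/2}. -/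
open scoped ComplexOrder

/-- A state on a unital C*-algebra: a linear functional `φ` with `φ 1 = 1` and `φ (a* a) ≥ 0`
for all `a`. -/
def IsState {A : Type*} [CStarAlgebra A] (φ : A →ₗ[ℂ] ℂ) : Prop :=
  φ 1 = 1 ∧ ∀ a : A, 0 ≤ φ (star a * a)

/-- The 2-seminorm `‖x‖₂ = (Re φ(x* x))^{1/2}` associated with a functional `φ`. -/
noncomputable def seminorm2 {A : Type*} [CStarAlgebra A] (φ : A →ₗ[ℂ] ℂ) (x : A) : ℝ :=
  Real.sqrt (φ (star x * x)).re

/-- The positive square root of a nonnegative function is a square root in the functional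
calculus, so a state is nonnegative on `cfc f a` whenever `f` is nonnegative on the spectrum. -/
theorem IsState.re_cfc_nonneg {A : Type*} [CStarAlgebra A] {φ : A →ₗ[ℂ] ℂ} (hφ : IsState φ)
    {a : A} {f : ℝ → ℝ} (hf : Continuous f)
    (h : ∀ t ∈ spectrum ℝ a, 0 ≤ f t) : 0 ≤ (φ (cfc f a)).re := by
  have hs : star (cfc (fun t => Real.sqrt (f t)) a) = cfc (fun t => Real.sqrt (f t)) a :=
    (cfc_predicate (R := ℝ) (p := IsSelfAdjoint) _ a).star_eq
  have hsq : cfc f a = star (cfc (fun t => Real.sqrt (f t)) a) *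
      cfc (fun t => Real.sqrt (f t)) a := by
    rw [hs, ← cfc_mul _ _ a]
    exact cfc_congr fun t ht => (Real.mul_self_sqrt (h t ht)).symm
  rw [hsq]
  exact (Complex.le_def.1 (hφ.2 _)).1

/-- The Cauchy–Schwarz inequality `Re φ(b) ≤ ‖b‖₂` for a self-adjoint element `b`. -/
theorem IsState.re_le_seminorm2 {A : Type*} [CStarAlgebra A] {φ : A →ₗ[ℂ] ℂ} (hφ : IsState φ)
    {b : A} (hb : IsSelfAdjoint b) : (φ b).re ≤ seminorm2 φ b := by
  apply Real.le_sqrt_of_sq_le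
  set c : ℝ := (φ b).re with hc
  have h := (Complex.le_def.1 (hφ.2 (b - (c : ℂ) • 1))).1
  have he : star (b - (c : ℂ) • (1 : A)) * (b - (c : ℂ) • 1) =
      star b * b - (2 * c : ℂ) • b + (c ^ 2 : ℂ) • 1 := by
    rw [star_sub, star_smul, star_one, hb.star_eq]
    simp only [Complex.star_def, Complex.conj_ofReal, sub_mul, mul_sub, smul_mul_assoc,
      mul_smul_comm, one_mul, mul_one]
    module
  rw [he, map_add, map_sub, map_smul, map_smul, hφ.1] at h
  simp only [Complex.zero_re, Complex.add_re, Complex.sub_re, smul_eq_mul, mul_one,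
    ← Complex.ofReal_ofNat, ← Complex.ofReal_mul, ← Complex.ofReal_pow, Complex.re_ofReal_mul,
    Complex.ofReal_re, ← hc] at h
  nlinarith

/-- The spectrum of `x* x` is contained in `[0, 1]` when `‖x‖ ≤ 1`. -/
theorem spectrum_star_mul_self_subset_Icc {A : Type*} [CStarAlgebra A] {x : A} (hx : ‖x‖ ≤ 1) :
    spectrum ℝ (star x * x) ⊆ Set.Icc 0 1 := by
  intro t ht
  have : Nontrivial A := by
    by_contra hA
    have := not_nontrivial_iff_subsingleton.1 hA
    simp [spectrum.of_subsingleton] at ht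
  refine ⟨spectrum_star_mul_self_nonneg t ht, (le_abs_self t).trans ?_⟩
  have h := spectrum.norm_le_norm_of_mem ht
  rw [CStarRing.norm_star_mul_self, Real.norm_eq_abs] at h
  nlinarith [norm_nonneg x]

/-- For a state `φ` on a unital C*-algebra and `x` with `‖x‖ ≤ 1`,
`‖|x| − 1‖₂ ≤ ‖x* x − 1‖₂^{1/2}`, where `|x| = (x* x)^{1/2}` is given by the continuous
functional calculus. -/
theorem stmt14 {A : Type*} [CStarAlgebra A] (φ : A →ₗ[ℂ] ℂ) (hφ : IsState φ)
    (x : A) (hx : ‖x‖ ≤ 1) :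
    seminorm2 φ (cfc Real.sqrt (star x * x) - 1)
      ≤ Real.sqrt (seminorm2 φ (star x * x - 1)) := by
  apply Real.sqrt_le_sqrt
  have hspec := spectrum_star_mul_self_subset_Icc hx
  have ha : IsSelfAdjoint (star x * x) := .star_mul_self x
  have hneg : seminorm2 φ (star x * x - 1) = seminorm2 φ (1 - star x * x) := by
    simp only [seminorm2]
    rw [← neg_sub 1 (star x * x), star_neg, neg_mul_neg]
  rw [hneg]
  refine le_trans ?_ (hφ.re_le_seminorm2 ((IsSelfAdjoint.one A).sub ha))
  have hs : star (cfc Real.sqrt (star x * x)) = cfc Real.sqrt (star x * x) :=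
    (cfc_predicate (R := ℝ) (p := IsSelfAdjoint) _ _).star_eq
  have hss : cfc Real.sqrt (star x * x) * cfc Real.sqrt (star x * x) = star x * x := by
    rw [← cfc_mul _ _ _]
    conv_rhs => rw [← cfc_id ℝ (star x * x)]
    exact cfc_congr fun t ht => Real.mul_self_sqrt (hspec ht).1
  have hpos := hφ.re_cfc_nonneg (a := star x * x) (f := fun t => Real.sqrt t - t)
    (by fun_prop) fun t ht => sub_nonneg.2 <| Real.le_sqrt_of_sq_le <| by
      nlinarith [(hspec ht).1, (hspec ht).2]
  rw [cfc_sub _ _ _, cfc_id' ℝ (star x * x), map_sub, Complex.sub_re] at hpos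
  rw [star_sub, star_one, hs, sub_mul, mul_sub, hss]
  simp only [one_mul, mul_one, map_sub, Complex.sub_re]
  linarith
end

section
/- Let A be a unital C*-algebra, let y ∈ A, and let h : ℝ → ℝ be a continuous function with 0 ≤ h(t) ≤ 1 for all t ≥ 0. Then ‖h(y·y*)·y − y‖² ≤ 2·‖h(y·y*)·(y·y*) − y·y*‖, where h(y·y*) denotes the continuous functional calculus of h applied to the positive element y·y*. -/
/-- For `y` in a unital C*-algebra and continuous `h : ℝ → ℝ` with
`0 ≤ h t ≤ 1` for `t ≥ 0`, one has `‖h(y y*) y − y‖² ≤ 2 ‖h(y y*)(y y*) − y y*‖`. -/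
theorem stmt15 {A : Type*} [CStarAlgebra A] (y : A) (h : ℝ → ℝ)
    (hcont : Continuous h) (hh : ∀ t : ℝ, 0 ≤ t → 0 ≤ h t ∧ h t ≤ 1) :
    ‖cfc h (y * star y) * y - y‖ ^ 2
      ≤ 2 * ‖cfc h (y * star y) * (y * star y) - y * star y‖ := by
  have hspec : ∀ t ∈ spectrum ℝ (y * star y), 0 ≤ t := by
    have := spectrum_star_mul_self_nonneg (b := star y)
    rwa [star_star] at this
  have ha : IsSelfAdjoint (y * star y) := .mul_star_self y
  set a := y * star y with hadef
  set c := cfc h a - 1 with hc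
  have hc_eq : c = cfc (fun t => h t - 1) a := by
    rw [cfc_sub h (fun _ => 1) a hcont.continuousOn continuousOn_const, cfc_const_one ℝ a]
  have hc_norm : ‖c‖ ≤ 1 := by
    rw [hc_eq]
    refine norm_cfc_le zero_le_one fun t ht => ?_
    obtain ⟨h0, h1⟩ := hh t (hspec t ht)
    rw [Real.norm_eq_abs, abs_le]
    constructor <;> linarith
  have hc_sa : star c = c := by
    rw [hc_eq]
    exact (cfc_predicate (fun t => h t - 1) a : IsSelfAdjoint _)
  have hy : cfc h a * y - y = c * y := by rw [hc, sub_mul, one_mul]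
  have hca : cfc h a * a - a = c * a := by rw [hc, sub_mul, one_mul]
  rw [hy, hca, sq, ← CStarRing.norm_self_mul_star, star_mul, hc_sa]
  calc ‖c * y * (star y * c)‖ = ‖c * a * c‖ := by rw [hadef]; simp only [mul_assoc]
    _ ≤ ‖c * a‖ * ‖c‖ := norm_mul_le _ _
    _ ≤ ‖c * a‖ * 1 := by gcongr
    _ ≤ 2 * ‖c * a‖ := by linarith [norm_nonneg (c * a)]
end

section
/- Let A be a C*-algebra, let e and p be projections in A, and let w ∈ A satisfy w*·w = e and w·w* ≤ p. Then ‖w²‖ ≤ ‖e·p‖. -/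
/-- An element of a C*-algebra with idempotent `w* w` satisfies `w w* w = w`. -/
theorem mul_star_mul_self_of_isIdempotentElem {A : Type*} [NonUnitalCStarAlgebra A] {w : A}
    (h : IsIdempotentElem (star w * w)) : w * (star w * w) = w := by
  rw [← sub_eq_zero, ← CStarRing.star_mul_self_eq_zero_iff]
  have h' : star w * w * (star w * w) = star w * w := h
  calc star (w * (star w * w) - w) * (w * (star w * w) - w)
      = star w * w * (star w * w) * (star w * w) - star w * w * (star w * w)
          - (star w * w * (star w * w) - star w * w) := by
        simp only [star_sub, star_mul, star_star]
        noncomm_ring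
    _ = 0 := by simp only [h', sub_self]

/-- Let `e, p` be projections in a C*-algebra and `w` with `w* w = e` and
`w w* ≤ p`. Then `‖w²‖ ≤ ‖e p‖`. -/
theorem stmt16 {A : Type*} [NonUnitalCStarAlgebra A] [PartialOrder A] [StarOrderedRing A]
    (e p w : A) (he : star e = e ∧ e * e = e) (hp : star p = p ∧ p * p = p)
    (hw1 : star w * w = e) (hw2 : w * star w ≤ p) :
    ‖w * w‖ ≤ ‖e * p‖ := by
  have hwe : w * e = w := by
    rw [← hw1]
    exact mul_star_mul_self_of_isIdempotentElem (hw1 ▸ he.2)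
  have hpw : p * w = w := by
    have h : p * (w * star w) = w * star w :=
      (IsStarProjection.mul_right_and_mul_left_of_nonneg_of_le ⟨hp.2, hp.1⟩
        (mul_star_self_nonneg w) hw2).2
    calc p * w = p * (w * star w) * w := by rw [mul_assoc, mul_assoc, hw1, hwe]
      _ = w := by rw [h, mul_assoc, hw1, hwe]
  have hw : ‖w‖ ≤ 1 := by
    have h1 : ‖e‖ ≤ 1 := IsStarProjection.norm_le e ⟨he.2, he.1⟩
    rw [← hw1, CStarRing.norm_star_mul_self] at h1
    nlinarith [norm_nonneg w]
  calc ‖w * w‖ = ‖w * (e * p) * w‖ := by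
        rw [← mul_assoc, hwe, mul_assoc, hpw]
    _ ≤ ‖w‖ * ‖e * p‖ * ‖w‖ := norm_mul₃_le
    _ ≤ 1 * ‖e * p‖ * 1 := by gcongr
    _ = ‖e * p‖ := by ring
end
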